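/- arXiv:0810.4898 — 6 statements merged into one kernel-verified Lean document; each statement's English description precedes it below -/
import Mathlib

section
/- Let d ≥ 1 and let A be a homogeneous polynomial of degree m ≥ 1 in d variables with complex coefficients, and let v ∈ ℝ^d. Then A is hyperbolic in direction v (that is, A(v) ≠ 0 and for every x ∈ ℝ^d every complex root t of the one-variable polynomial t ↦ A(x + t·v) is real) if and only if A(v + i·y) ≠ 0 for all y ∈ ℝ^d. -/
open MvPolynomial

/-- A homogeneous polynomial `A` with complex coefficients is *hyperbolic in direction
`v ∈ ℝ^d`* if `A(v) ≠ 0` and for every real `x`, every complex root `t` of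
`t ↦ A(x + t v)` is real. -/
def IsHyperbolicDir {d : ℕ} (A : MvPolynomial (Fin d) ℂ) (v : Fin d → ℝ) : Prop :=
  eval (fun j => (v j : ℂ)) A ≠ 0 ∧
    ∀ x : Fin d → ℝ, ∀ t : ℂ,
      eval (fun j => (x j : ℂ) + t * (v j : ℂ)) A = 0 → t.im = 0

theorem MvPolynomial.IsHomogeneous.eval_mul_left {σ R : Type*} [CommSemiring R] {m : ℕ}
    {A : MvPolynomial σ R} (hA : A.IsHomogeneous m) (c : R) (z : σ → R) :
    eval (fun j => c * z j) A = c ^ m * eval z A := by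
  simp only [eval_eq, Finset.mul_sum, mul_pow, Finset.prod_mul_distrib]
  refine Finset.sum_congr rfl fun s hs => ?_
  have hdeg : ∑ i ∈ s.support, s i = m :=
    (hA.degree_eq_sum_deg_support hs).symm
  rw [Finset.prod_pow_eq_pow_sum, hdeg]
  ring

/-- hyperbolicity of a homogeneous polynomial in direction `v` is
equivalent to nonvanishing of `A` on `v + i ℝ^d`. -/
theorem hyperbolic_iff_nonvanishing {d m : ℕ} (hd : 1 ≤ d) (hm : 1 ≤ m)
    (A : MvPolynomial (Fin d) ℂ) (hA : A.IsHomogeneous m) (hA0 : A ≠ 0)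
    (v : Fin d → ℝ) :
    IsHyperbolicDir A v ↔
      ∀ y : Fin d → ℝ, eval (fun j => (v j : ℂ) + Complex.I * (y j : ℂ)) A ≠ 0 := by
  constructor
  · rintro ⟨-, h⟩ y hy
    have key := h y (-Complex.I) (by
      have hz : (fun j => (y j : ℂ) + -Complex.I * (v j : ℂ)) =
          fun j => -Complex.I * ((v j : ℂ) + Complex.I * (y j : ℂ)) := by
        funext j
        linear_combination (y j : ℂ) * Complex.I_mul_I
      rw [hz, hA.eval_mul_left, hy, mul_zero])
    simp at key
  · intro h
    refine ⟨by simpa using h 0, fun x t ht => ?_⟩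
    by_contra hb
    refine h (fun j => -(x j + t.re * v j) / t.im) ?_
    have hb' : (t.im : ℂ) ≠ 0 := by exact_mod_cast hb
    have hz : (fun j => (x j : ℂ) + t * (v j : ℂ)) = fun j => (t.im * Complex.I) *
        ((v j : ℂ) + Complex.I * ((-(x j + t.re * v j) / t.im : ℝ) : ℂ)) := by
      funext j
      push_cast
      field_simp
      linear_combination (-(v j : ℂ)) * Complex.re_add_im t +
        ((x j : ℂ) + t.re * v j) * Complex.I_sq
    rw [hz, hA.eval_mul_left] at ht
    exact (mul_eq_zero.mp ht).resolve_left
      (pow_ne_zero _ (mul_ne_zero hb' Complex.I_ne_zero))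
end

section
/- Let q be a polynomial in d complex variables vanishing to order m ≥ 1 at the origin; write q = q̃ + R where q̃ ≠ 0 is the homogeneous part of q of degree m and R(z) = O(|z|^{m+1}) as z → 0. For ε > 0 let V_ε := { z ∈ ℂ^d : |z| = 1 and q(ε·z) = 0 }, and let V₀ := { z ∈ ℂ^d : |z| = 1 and q̃(z) = 0 }, where |·| is the Hermitian norm on ℂ^d. Then V_ε converges to V₀ in the Hausdorff metric as ε → 0⁺; precisely, the (extended) Hausdorff distance between V_ε and V₀ tends to 0 as ε → 0 along positive reals (with the convention that the Hausdorff distance between two empty sets is 0). -/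
open MvPolynomial

/-- A complex polynomial of degree at most `N` whose value at `1` exceeds `2 ^ N` times its value
at `0` in norm has a zero in the closed unit disc. -/
lemma Polynomial.exists_isRoot_norm_le_one {p : Polynomial ℂ} {N : ℕ} (hN : p.natDegree ≤ N)
    (hp : 2 ^ N * ‖p.eval 0‖ < ‖p.eval 1‖) : ∃ t : ℂ, ‖t‖ ≤ 1 ∧ p.eval t = 0 := by
  by_contra! hroot
  have hp0 : p ≠ 0 := by rintro rfl; simp at hp
  have key : ∀ s : Multiset ℂ, (∀ a ∈ s, 1 < ‖a‖) →
      ‖(s.map fun a => 1 - a).prod‖ ≤ 2 ^ s.card * ‖(s.map fun a => 0 - a).prod‖ := by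
    intro s
    induction s using Multiset.induction_on with
    | empty => simp
    | cons a s ih =>
      intro hs
      have ha : 1 < ‖a‖ := hs a (Multiset.mem_cons_self a s)
      have hfactor : ‖1 - a‖ ≤ 2 * ‖0 - a‖ := by
        have := norm_sub_le 1 a
        rw [norm_one] at this
        rw [zero_sub, norm_neg]
        linarith
      have ih' := ih fun b hb => hs b (Multiset.mem_cons_of_mem hb)
      simp only [Multiset.map_cons, Multiset.prod_cons, Multiset.card_cons, norm_mul]
      calc ‖1 - a‖ * ‖(s.map fun a => 1 - a).prod‖
          ≤ (2 * ‖0 - a‖) * (2 ^ s.card * ‖(s.map fun a => 0 - a).prod‖) := by gcongr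
        _ = _ := by ring
  have hroots : ∀ a ∈ p.roots, 1 < ‖a‖ := fun a ha => by
    by_contra! hle
    exact hroot a hle (Polynomial.isRoot_of_mem_roots ha)
  have hbound := key p.roots hroots
  have hcard : p.roots.card ≤ N := (Polynomial.card_roots' p).trans hN
  have hsplit := IsAlgClosed.splits p
  rw [hsplit.eval_eq_prod_roots, hsplit.eval_eq_prod_roots, norm_mul, norm_mul] at hp
  have : ‖(p.roots.map fun a => 1 - a).prod‖ ≤ 2 ^ N * ‖(p.roots.map fun a => 0 - a).prod‖ :=
    hbound.trans (by gcongr; norm_num)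
  nlinarith [mul_le_mul_of_nonneg_left this (norm_nonneg p.leadingCoeff)]

namespace MvPolynomial

variable {d : ℕ}

/-- The restriction of a multivariate polynomial to the affine line `t ↦ z + t • v`. -/
noncomputable def restrictLine (h : MvPolynomial (Fin d) ℂ) (z v : EuclideanSpace ℂ (Fin d)) :
    Polynomial ℂ :=
  aeval (fun j => Polynomial.C (z j) + Polynomial.C (v j) * Polynomial.X) h

lemma eval_restrictLine (h : MvPolynomial (Fin d) ℂ) (z v : EuclideanSpace ℂ (Fin d)) (t : ℂ) :
    (h.restrictLine z v).eval t = eval (z + t • v) h := by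
  have hcomp : (Polynomial.aeval t).comp
      (aeval fun j => Polynomial.C (z j) + Polynomial.C (v j) * Polynomial.X) =
      (aeval (R := ℂ) fun j => (z + t • v) j) := by
    ext j
    simp only [AlgHom.comp_apply, aeval_X, Polynomial.coe_aeval_eq_eval, Polynomial.eval_add,
      Polynomial.eval_mul, Polynomial.eval_C, Polynomial.eval_X, PiLp.add_apply, PiLp.smul_apply,
      smul_eq_mul, mul_comm]
  exact DFunLike.congr_fun hcomp h

lemma natDegree_restrictLine_le (h : MvPolynomial (Fin d) ℂ) (z v : EuclideanSpace ℂ (Fin d)) :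
    (h.restrictLine z v).natDegree ≤ h.totalDegree := by
  have := aeval_natDegree_le (n := 1) h le_rfl
    (fun j => Polynomial.C (z j) + Polynomial.C (v j) * Polynomial.X) fun j => by compute_degree
  simpa [restrictLine] using this

lemma exists_eval_eq_zero_on_segment {h : MvPolynomial (Fin d) ℂ} {N : ℕ}
    (hN : h.totalDegree ≤ N) {z v : EuclideanSpace ℂ (Fin d)}
    (hlt : 2 ^ N * ‖eval z h‖ < ‖eval (z + v) h‖) :
    ∃ t : ℂ, ‖t‖ ≤ 1 ∧ eval (z + t • v) h = 0 := by
  have := Polynomial.exists_isRoot_norm_le_one ((h.natDegree_restrictLine_le z v).trans hN)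
    (by simpa [eval_restrictLine] using hlt)
  simpa only [eval_restrictLine] using this

/-- Arbitrarily small multiples of `v` lead away from the zero set of `h`, provided that
`z + v` does not belong to it. -/
lemma exists_eval_add_smul_ne_zero {h : MvPolynomial (Fin d) ℂ} {z v : EuclideanSpace ℂ (Fin d)}
    (hv : eval (z + v) h ≠ 0) {r : ℝ} (hr : 0 < r) :
    ∃ t : ℂ, ‖t • v‖ < r ∧ eval (z + t • v) h ≠ 0 := by
  have hp : h.restrictLine z v ≠ 0 := by
    intro h0
    apply hv
    simpa [h0] using (h.eval_restrictLine z v 1).symm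
  have hne : ∀ᶠ t in nhdsWithin (0 : ℂ) {0}ᶜ, (h.restrictLine z v).eval t ≠ 0 := by
    have hfin : ({t | (h.restrictLine z v).IsRoot t} \ {0}).Finite :=
      (Polynomial.finite_setOfPred_isRoot hp).subset Set.sdiff_subset
    have := hfin.isClosed.isOpen_compl.mem_nhds (x := (0 : ℂ)) (by simp)
    filter_upwards [nhdsWithin_le_nhds this, self_mem_nhdsWithin] with t ht ht0 h0
    exact ht ⟨h0, ht0⟩
  have hsmall : ∀ᶠ t in nhdsWithin (0 : ℂ) {0}ᶜ, ‖t • v‖ < r := by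
    have hc : Continuous fun t : ℂ => ‖t • v‖ := by fun_prop
    exact nhdsWithin_le_nhds (hc.continuousAt.eventually_lt continuousAt_const (by simpa using hr))
  obtain ⟨t, ht, ht'⟩ := (hsmall.and hne).exists
  exact ⟨t, ht, by rwa [← eval_restrictLine]⟩

lemma continuous_eval_euclidean (h : MvPolynomial (Fin d) ℂ) :
    Continuous fun z : EuclideanSpace ℂ (Fin d) => eval z h :=
  (continuous_eval h).comp (PiLp.continuous_ofLp 2 _)

lemma IsHomogeneous.eval_mul {σ R : Type*} [CommSemiring R] {φ : MvPolynomial σ R} {n : ℕ}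
    (hφ : φ.IsHomogeneous n) (c : R) (x : σ → R) :
    eval (fun j => c * x j) φ = c ^ n * eval x φ := by
  rw [eval_eq, eval_eq, Finset.mul_sum]
  refine Finset.sum_congr rfl fun e he => ?_
  have hdeg : ∑ i ∈ e.support, e i = n := by
    have hweight := hφ (mem_support_iff.1 he)
    rw [Pi.one_def, ← Finsupp.degree_eq_weight_one] at hweight
    exact hweight
  simp only [mul_pow, Finset.prod_mul_distrib, Finset.prod_pow_eq_pow_sum, hdeg]
  ring

/-- The rescaled polynomial `z ↦ s⁻ᵐ q (s z)`, extended continuously to `s = 0`, when `q`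
vanishes to order at least `m` at the origin. -/
noncomputable def rescale (m : ℕ) (q : MvPolynomial (Fin d) ℂ) (s : ℝ) :
    MvPolynomial (Fin d) ℂ :=
  ∑ k ∈ Finset.range (q.totalDegree + 1) with m ≤ k,
    C ((s : ℂ) ^ (k - m)) * homogeneousComponent k q

lemma eval_rescale (m : ℕ) (q : MvPolynomial (Fin d) ℂ) (s : ℝ) (x : Fin d → ℂ) :
    eval x (rescale m q s) = ∑ k ∈ Finset.range (q.totalDegree + 1) with m ≤ k,
      (s : ℂ) ^ (k - m) * eval x (homogeneousComponent k q) := by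
  simp [rescale]

lemma totalDegree_rescale_le (m : ℕ) (q : MvPolynomial (Fin d) ℂ) (s : ℝ) :
    (rescale m q s).totalDegree ≤ q.totalDegree := by
  refine totalDegree_finsetSum_le fun k hk => ?_
  rw [Finset.mem_filter, Finset.mem_range] at hk
  refine (totalDegree_mul _ _).trans ?_
  rw [totalDegree_C, zero_add]
  exact (homogeneousComponent_isHomogeneous k q).totalDegree_le.trans (by omega)

lemma continuous_eval_rescale (m : ℕ) (q : MvPolynomial (Fin d) ℂ) :
    Continuous fun p : ℝ × EuclideanSpace ℂ (Fin d) => eval p.2 (rescale m q p.1) := by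
  simp only [eval_rescale]
  refine continuous_finsetSum _ fun k _ => ?_
  exact ((Complex.continuous_ofReal.comp continuous_fst).pow _).mul
    ((continuous_eval_euclidean _).comp continuous_snd)

lemma rescale_zero {m : ℕ} {q : MvPolynomial (Fin d) ℂ} (hq : homogeneousComponent m q ≠ 0) :
    rescale m q 0 = homogeneousComponent m q := by
  have hm : m ≤ q.totalDegree := by
    by_contra! hlt
    exact hq (homogeneousComponent_eq_zero _ _ hlt)
  rw [rescale, Finset.sum_eq_single m]
  · simp
  · intro k hk hkm
    rw [Finset.mem_filter] at hk
    have : k - m ≠ 0 := by omega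
    simp [this]
  · intro hnot
    exact absurd (Finset.mem_filter.2 ⟨Finset.mem_range.2 (by omega), le_rfl⟩) hnot

lemma eval_mul_eq_pow_mul_eval_rescale {m : ℕ} {q : MvPolynomial (Fin d) ℂ}
    (hlow : ∀ k < m, homogeneousComponent k q = 0) (s : ℝ) (x : Fin d → ℂ) :
    eval (fun j => (s : ℂ) * x j) q = (s : ℂ) ^ m * eval x (rescale m q s) := by
  conv_lhs => rw [← sum_homogeneousComponent q]
  rw [eval_rescale, map_sum, Finset.mul_sum, Finset.sum_filter]
  refine Finset.sum_congr rfl fun k _ => ?_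
  rw [(homogeneousComponent_isHomogeneous k q).eval_mul]
  split_ifs with hk
  · rw [← mul_assoc, ← pow_add, Nat.add_sub_cancel' hk]
  · rw [hlow k (by omega)]
    simp

open scoped InnerProductSpace

/-- Among the zeros of `g` in the closed unit ball whose `z₀`-coordinate is real and at least `a`,
one with maximal `z₀`-coordinate lies on the unit sphere. -/
lemma exists_norm_eq_one_eval_eq_zero {g : MvPolynomial (Fin d) ℂ}
    {z₀ c : EuclideanSpace ℂ (Fin d)} (hz₀ : ‖z₀‖ = 1) (hc : ⟪z₀, c⟫_ℂ = 1) {a : ℝ}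
    (hne : ∀ s ∈ Set.Icc a 1, eval ((s : ℂ) • c) g ≠ 0)
    (hstart : ∃ z : EuclideanSpace ℂ (Fin d), ‖z‖ ≤ 1 ∧ eval z g = 0 ∧ ⟪z₀, z⟫_ℂ = a) :
    ∃ z : EuclideanSpace ℂ (Fin d), ‖z‖ = 1 ∧ eval z g = 0 ∧ a ≤ (⟪z₀, z⟫_ℂ).re := by
  have hinner : Continuous fun z : EuclideanSpace ℂ (Fin d) => ⟪z₀, z⟫_ℂ := by fun_prop
  have hre := Complex.continuous_re.comp hinner
  have him := Complex.continuous_im.comp hinner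
  let A : Set (EuclideanSpace ℂ (Fin d)) := Metric.closedBall 0 1 ∩
    ({z | eval z g = 0} ∩ ({z | a ≤ (⟪z₀, z⟫_ℂ).re} ∩ {z | (⟪z₀, z⟫_ℂ).im = 0}))
  have hA : IsCompact A := (isCompact_closedBall 0 1).inter_right
    ((isClosed_eq (continuous_eval_euclidean g) continuous_const).inter
      ((isClosed_le continuous_const hre).inter (isClosed_eq him continuous_const)))
  obtain ⟨w, hw, hwg, hwa⟩ := hstart
  have hwA : w ∈ A := by
    refine ⟨by simpa using hw, hwg, ?_, ?_⟩ <;> simp [hwa]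
  obtain ⟨z, ⟨hz, hzg, hza, hzim⟩, hmax⟩ := hA.exists_isMaxOn ⟨w, hwA⟩ hre.continuousOn
  simp only [Set.mem_ofPred_eq, mem_closedBall_zero_iff] at hz hzg hza hzim
  refine ⟨z, ?_, hzg, hza⟩
  by_contra hz1
  replace hz1 : ‖z‖ < 1 := lt_of_le_of_ne hz hz1
  set s : ℝ := (⟪z₀, z⟫_ℂ).re with hs
  have hzs : ⟪z₀, z⟫_ℂ = (s : ℂ) := Complex.ext (by simp [hs]) (by simp [hzim])
  have hs1 : s ≤ 1 := by
    have h1 := (Complex.re_le_norm _).trans (norm_inner_le_norm (𝕜 := ℂ) z₀ z)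
    rw [hz₀, one_mul] at h1
    exact h1.trans hz
  have hr : 0 < (1 - ‖z‖) / 2 := by linarith
  have hv : eval (z + ((s : ℂ) • c - z)) g ≠ 0 := by
    rw [add_sub_cancel]
    exact hne s ⟨hza, hs1⟩
  obtain ⟨t₁, ht₁, ht₁g⟩ := exists_eval_add_smul_ne_zero hv hr
  set v := t₁ • ((s : ℂ) • c - z) with hvdef
  have hz₀v : ⟪z₀, v⟫_ℂ = 0 := by
    simp [hvdef, hc, hzs]
  have hlt : ∀ᶠ τ : ℝ in nhds 0, 2 ^ g.totalDegree * ‖eval (z + (τ : ℂ) • z₀) g‖ <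
      ‖eval (z + (τ : ℂ) • z₀ + v) g‖ := by
    have hc₁ : Continuous fun τ : ℝ =>
        2 ^ g.totalDegree * ‖eval (z + (τ : ℂ) • z₀ : EuclideanSpace ℂ (Fin d)) g‖ :=
      continuous_const.mul ((continuous_eval_euclidean g).comp
        (f := fun τ : ℝ => z + (τ : ℂ) • z₀) (by fun_prop)).norm
    have hc₂ : Continuous fun τ : ℝ =>
        ‖eval (z + (τ : ℂ) • z₀ + v : EuclideanSpace ℂ (Fin d)) g‖ :=
      ((continuous_eval_euclidean g).comp
        (f := fun τ : ℝ => z + (τ : ℂ) • z₀ + v) (by fun_prop)).norm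
    refine hc₁.continuousAt.eventually_lt hc₂.continuousAt ?_
    simp only [Complex.ofReal_zero, zero_smul, add_zero]
    rw [hzg, norm_zero, mul_zero]
    exact norm_pos_iff.2 ht₁g
  obtain ⟨τ, hτ, hτr, hτ0⟩ := ((hlt.filter_mono nhdsWithin_le_nhds).and
    (((eventually_lt_nhds hr).filter_mono nhdsWithin_le_nhds).and
      (self_mem_nhdsWithin (s := Set.Ioi 0)))).exists
  obtain ⟨t, ht, hroot⟩ := exists_eval_eq_zero_on_segment le_rfl hτ
  have hcoord : ⟪z₀, z + (τ : ℂ) • z₀ + t • v⟫_ℂ = ((s + τ : ℝ) : ℂ) := by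
    simp [hzs, hz₀, hz₀v]
  have hnorm : ‖z + (τ : ℂ) • z₀ + t • v‖ ≤ 1 := by
    have h1 : ‖(τ : ℂ) • z₀‖ = τ := by simp [norm_smul, hz₀, abs_of_pos hτ0]
    have h2 : ‖t • v‖ ≤ ‖v‖ := by
      rw [norm_smul]
      exact mul_le_of_le_one_left (norm_nonneg v) ht
    have h3 := norm_add₃_le (a := z) (b := (τ : ℂ) • z₀) (c := t • v)
    linarith
  have hmem : z + (τ : ℂ) • z₀ + t • v ∈ A := by
    refine ⟨by simpa using hnorm, hroot, ?_, ?_⟩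
    · simp only [Set.mem_ofPred_eq, hcoord, Complex.ofReal_re]
      linarith
    · simp only [Set.mem_ofPred_eq, hcoord, Complex.ofReal_im]
  have hle := hmax hmem
  simp only [Set.mem_ofPred_eq, Function.comp_apply, hcoord, Complex.ofReal_re] at hle
  linarith

lemma IsHomogeneous.exists_inner_eq_one_eval_ne_zero {p : MvPolynomial (Fin d) ℂ} {m : ℕ}
    (hp : p.IsHomogeneous m) (hp0 : p ≠ 0) {z₀ : EuclideanSpace ℂ (Fin d)} (hz₀ : ‖z₀‖ = 1) :
    ∃ c : EuclideanSpace ℂ (Fin d), ⟪z₀, c⟫_ℂ = 1 ∧ eval c p ≠ 0 := by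
  obtain ⟨x, hx⟩ : ∃ x : Fin d → ℂ, eval x p ≠ 0 := by
    by_contra! hall
    exact hp0 (MvPolynomial.funext fun x => by simpa using hall x)
  have hv : eval (z₀ + (WithLp.toLp 2 x - z₀) : EuclideanSpace ℂ (Fin d)) p ≠ 0 := by
    rwa [add_sub_cancel]
  obtain ⟨t, ht, htp⟩ := exists_eval_add_smul_ne_zero hv one_pos
  set v := t • (WithLp.toLp 2 x - z₀)
  have hinner : ⟪z₀, z₀ + v⟫_ℂ ≠ 0 := by
    intro h0
    rw [inner_add_right, inner_self_eq_norm_sq_to_K, hz₀] at h0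
    have h1 := norm_inner_le_norm (𝕜 := ℂ) z₀ v
    rw [eq_neg_of_add_eq_zero_right h0, hz₀] at h1
    simp at h1
    linarith
  refine ⟨(⟪z₀, z₀ + v⟫_ℂ)⁻¹ • (z₀ + v), ?_, ?_⟩
  · rw [inner_smul_right, inv_mul_cancel₀ hinner]
  · have := hp.eval_mul (⟪z₀, z₀ + v⟫_ℂ)⁻¹ (z₀ + v).ofLp
    exact fun h0 => mul_ne_zero (pow_ne_zero m (inv_ne_zero hinner)) htp (this.symm.trans h0)

section Family

variable {h : ℝ → MvPolynomial (Fin d) ℂ}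

lemma eventually_forall_eval_ne_zero
    (hc : Continuous fun p : ℝ × EuclideanSpace ℂ (Fin d) => eval p.2 (h p.1))
    {K : Set (EuclideanSpace ℂ (Fin d))} (hK : IsCompact K) (h0 : ∀ z ∈ K, eval z (h 0) ≠ 0) :
    ∀ᶠ s in nhds 0, ∀ z ∈ K, eval z (h s) ≠ 0 :=
  hK.eventually_forall_of_forall_eventually fun z hz => hc.continuousAt.eventually_ne (h0 z hz)

lemma eventually_exists_zero_near
    (hc : Continuous fun p : ℝ × EuclideanSpace ℂ (Fin d) => eval p.2 (h p.1))
    {N m : ℕ} (hN : ∀ s, (h s).totalDegree ≤ N) (hhom : (h 0).IsHomogeneous m) (h0 : h 0 ≠ 0)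
    {z₀ : EuclideanSpace ℂ (Fin d)} (hz₀ : ‖z₀‖ = 1) (hzero : eval z₀ (h 0) = 0)
    {δ : ℝ} (hδ : 0 < δ) :
    ∀ᶠ s in nhds 0, ∃ z : EuclideanSpace ℂ (Fin d), ‖z‖ = 1 ∧ eval z (h s) = 0 ∧ dist z₀ z < δ := by
  obtain ⟨c, hz₀c, hcne⟩ := hhom.exists_inner_eq_one_eval_ne_zero h0 hz₀
  have hscale (s : ℂ) (z : EuclideanSpace ℂ (Fin d)) :
      eval (s • z) (h 0) = s ^ m * eval z (h 0) := hhom.eval_mul s z.ofLp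
  obtain ⟨a, ha0, ha1, haδ⟩ : ∃ a : ℝ, 0 < a ∧ a < 1 ∧ 2 - 2 * a < δ ^ 2 := by
    refine ⟨max (1 / 2) (1 - δ ^ 2 / 4), by positivity, ?_, ?_⟩
    · exact max_lt (by norm_num) (by nlinarith)
    · have := le_max_right (1 / 2) (1 - δ ^ 2 / 4)
      nlinarith
  have haz₀ : eval ((a : ℂ) • z₀) (h 0) = 0 := by rw [hscale, hzero, mul_zero]
  have hsc : ∀ s : ℝ, 0 < s → eval ((s : ℂ) • c) (h 0) ≠ 0 := fun s hs => by
    rw [hscale]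
    exact mul_ne_zero (pow_ne_zero m (by exact_mod_cast hs.ne')) hcne
  obtain ⟨t₁, ht₁, ht₁h⟩ := exists_eval_add_smul_ne_zero (h := h 0) (z := (a : ℂ) • z₀)
    (v := (a : ℂ) • c - (a : ℂ) • z₀) (by rw [add_sub_cancel]; exact hsc a ha0) (sub_pos.2 ha1)
  set v := t₁ • ((a : ℂ) • c - (a : ℂ) • z₀) with hvdef
  have hz₀v : ⟪z₀, v⟫_ℂ = 0 := by
    simp [hvdef, hz₀c, hz₀]
  have hcont (z : EuclideanSpace ℂ (Fin d)) : Continuous fun s => eval z (h s) :=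
    hc.comp (f := fun s : ℝ => (s, z)) (by fun_prop)
  have hlt : ∀ᶠ s in nhds 0,
      2 ^ N * ‖eval ((a : ℂ) • z₀) (h s)‖ < ‖eval ((a : ℂ) • z₀ + v) (h s)‖ := by
    have hc₁ : Continuous fun s => 2 ^ N * ‖eval ((a : ℂ) • z₀) (h s)‖ :=
      continuous_const.mul (hcont _).norm
    refine hc₁.continuousAt.eventually_lt (hcont ((a : ℂ) • z₀ + v)).norm.continuousAt ?_
    rw [haz₀, norm_zero, mul_zero]
    exact norm_pos_iff.2 ht₁h
  have hK : IsCompact ((fun s : ℝ => (s : ℂ) • c) '' Set.Icc a 1) :=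
    isCompact_Icc.image (by fun_prop)
  have hne := eventually_forall_eval_ne_zero hc hK (by
    rintro _ ⟨s, hs, rfl⟩
    exact hsc s (ha0.trans_le hs.1))
  filter_upwards [hlt, hne] with s hs hs'
  obtain ⟨t, ht, hroot⟩ := exists_eval_eq_zero_on_segment (hN s) hs
  obtain ⟨z, hz, hzh, hza⟩ := exists_norm_eq_one_eval_eq_zero hz₀ hz₀c
    (fun r hr => hs' _ ⟨r, hr, rfl⟩) ⟨(a : ℂ) • z₀ + t • v, by
      have h1 : ‖(a : ℂ) • z₀‖ = a := by simp [norm_smul, hz₀, abs_of_pos ha0]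
      have h2 : ‖t • v‖ ≤ ‖v‖ := by
        rw [norm_smul]
        exact mul_le_of_le_one_left (norm_nonneg v) ht
      have h3 := norm_add_le ((a : ℂ) • z₀) (t • v)
      linarith, hroot, by
      simp [hz₀, hz₀v]⟩
  refine ⟨z, hz, hzh, ?_⟩
  rw [dist_eq_norm]
  refine lt_of_pow_lt_pow_left₀ 2 hδ.le ?_
  have := norm_sub_sq (𝕜 := ℂ) z₀ z
  rw [hz₀, hz] at this
  simp only [RCLike.re_to_complex] at this
  linarith

end Family

end MvPolynomial

/-- the algebraic tangent cone is the limiting secant cone. If `q`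
vanishes to order `m ≥ 1` at `0` with homogeneous part `q̃` of degree `m`, then the
slices `V_ε = {|z| = 1, q(εz) = 0}` of the zero set converge in the Hausdorff
(extended) metric to `V₀ = {|z| = 1, q̃(z) = 0}` as `ε → 0⁺`. -/
theorem secant_cone_hausdorff_limit {d m : ℕ} (hm : 1 ≤ m)
    (q : MvPolynomial (Fin d) ℂ)
    (hlow : ∀ k < m, homogeneousComponent k q = 0)
    (hm0 : homogeneousComponent m q ≠ 0) :
    Filter.Tendsto
      (fun ε : ℝ => EMetric.hausdorffEdist
        {z : EuclideanSpace ℂ (Fin d) | ‖z‖ = 1 ∧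
          eval (fun j => (ε : ℂ) * z j) q = 0}
        {z : EuclideanSpace ℂ (Fin d) | ‖z‖ = 1 ∧
          eval (fun j => z j) (homogeneousComponent m q) = 0})
      (nhdsWithin 0 (Set.Ioi 0)) (nhds 0) := by
  set V₀ := {z : EuclideanSpace ℂ (Fin d) | ‖z‖ = 1 ∧
    eval (fun j => z j) (homogeneousComponent m q) = 0}
  have hc := continuous_eval_rescale m q
  have hr0 := rescale_zero hm0
  have hsphere : IsCompact {z : EuclideanSpace ℂ (Fin d) | ‖z‖ = 1} := by
    have heq : {z : EuclideanSpace ℂ (Fin d) | ‖z‖ = 1} = Metric.sphere 0 1 :=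
      Set.ext fun z => mem_sphere_zero_iff_norm.symm
    exact heq ▸ isCompact_sphere 0 1
  have hV₀c : IsCompact V₀ :=
    hsphere.inter_right (isClosed_eq (continuous_eval_euclidean _) continuous_const)
  refine ENNReal.tendsto_nhds_zero.2 fun η hη => ?_
  obtain ⟨δ, hδ, hδη⟩ : ∃ δ : ℝ, 0 < δ ∧ ENNReal.ofReal δ ≤ η := by
    obtain ⟨δ, hδ, hδη⟩ := ENNReal.lt_iff_exists_nnreal_btwn.1 hη
    exact ⟨δ, by exact_mod_cast hδ, by simpa using hδη.le⟩
  have hfar : ∀ᶠ s in nhds 0, ∀ z ∈ {z : EuclideanSpace ℂ (Fin d) | ‖z‖ = 1} ∩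
      {z | ENNReal.ofReal δ ≤ Metric.infEDist z V₀}, eval z (rescale m q s) ≠ 0 := by
    refine eventually_forall_eval_ne_zero hc
      (hsphere.inter_right (isClosed_le continuous_const Metric.continuous_infEDist)) ?_
    rintro z ⟨hz, hzV⟩ h0
    rw [hr0] at h0
    have hzV₀ : z ∈ V₀ := ⟨hz, h0⟩
    rw [Set.mem_ofPred_eq, Metric.infEDist_zero_of_mem hzV₀] at hzV
    exact absurd hzV (by simpa using hδ)
  have hnear : ∀ᶠ s in nhds 0, ∀ z₀ ∈ V₀, ∃ z : EuclideanSpace ℂ (Fin d),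
      ‖z‖ = 1 ∧ eval z (rescale m q s) = 0 ∧ dist z₀ z < δ := by
    refine hV₀c.eventually_forall_of_forall_eventually fun z₀ hz₀ => ?_
    have hs := eventually_exists_zero_near hc (totalDegree_rescale_le m q)
      (hr0 ▸ homogeneousComponent_isHomogeneous m q) (hr0 ▸ hm0) hz₀.1 (hr0 ▸ hz₀.2) (half_pos hδ)
    filter_upwards [hs.prod_nhds (Metric.ball_mem_nhds z₀ (half_pos hδ))]
    rintro ⟨s, y⟩ ⟨⟨z, hz, hzs, hd⟩, hy⟩
    refine ⟨z, hz, hzs, ?_⟩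
    have := dist_triangle y z₀ z
    exact this.trans_lt (by linarith [show dist y z₀ < δ / 2 from hy])
  filter_upwards [nhdsWithin_le_nhds hfar, nhdsWithin_le_nhds hnear, self_mem_nhdsWithin]
    with s hs₁ hs₂ hs
  have hs0 : (s : ℂ) ^ m ≠ 0 := pow_ne_zero m (by exact_mod_cast (ne_of_gt hs))
  have hiff (z : EuclideanSpace ℂ (Fin d)) :
      eval (fun j => (s : ℂ) * z j) q = 0 ↔ eval z (rescale m q s) = 0 := by
    rw [eval_mul_eq_pow_mul_eval_rescale hlow, mul_eq_zero, or_iff_right hs0]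
  refine (Metric.hausdorffEDist_le_of_infEDist ?_ ?_).trans hδη
  · rintro z ⟨hz, hzq⟩
    by_contra! hlt
    exact hs₁ z ⟨hz, hlt.le⟩ ((hiff z).1 hzq)
  · intro z₀ hz₀
    obtain ⟨z, hz, hzs, hd⟩ := hs₂ z₀ hz₀
    refine (Metric.infEDist_le_edist_of_mem (Set.mem_ofPred.2 ⟨hz, (hiff z).2 hzs⟩)).trans ?_
    rw [edist_dist]
    exact ENNReal.ofReal_le_ofReal hd.le
end

section
/- Let A be a real homogeneous polynomial of degree m ≥ 1 in d variables that is hyperbolic in direction v ∈ ℝ^d. Then: (1) the set H = { u ∈ ℝ^d : A is hyperbolic in direction u } is open; (2) the connected component K^v(A) of H containing v is a convex cone (it is closed under addition and under multiplication by positive reals); (3) there is a real constant c ≠ 0 such that c·A(x) > 0 for all x ∈ K^v(A) and c·A(x) = 0 for all x in the topological boundary of K^v(A); and (4) for every x ∈ K^v(A), every root of the real polynomial t ↦ A(x + t·v) is real and negative. -/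
open MvPolynomial

/-- A real polynomial `A` is *hyperbolic in direction `v ∈ ℝ^d`* if `A(v) ≠ 0`
and for every real `x`, every complex root `t` of `t ↦ A(x + t v)` is real. -/
def RealHyperbolicDir {d : ℕ} (A : MvPolynomial (Fin d) ℝ) (v : Fin d → ℝ) : Prop :=
  eval v A ≠ 0 ∧
    ∀ x : Fin d → ℝ, ∀ t : ℂ,
      eval (fun j => (x j : ℂ) + t * (v j : ℂ)) (A.map (algebraMap ℝ ℂ)) = 0 → t.im = 0

namespace HyperbolicityCone

section Homogeneous

variable {σ R : Type*} [CommSemiring R] {m : ℕ}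

theorem eval_smul_of_isHomogeneous {B : MvPolynomial σ R} (hB : B.IsHomogeneous m)
    (c : R) (z : σ → R) : eval (c • z) B = c ^ m * eval z B := by
  rw [eval_eq, eval_eq, Finset.mul_sum]
  refine Finset.sum_congr rfl fun s hs => ?_
  rw [hB.degree_eq_sum_deg_support hs, ← Finset.prod_pow_eq_pow_sum]
  simp only [Pi.smul_apply, smul_eq_mul, mul_pow, Finset.prod_mul_distrib]
  ring

theorem natDegree_coeff_prod_line (s : Finset σ) (e : σ → ℕ) (z w : σ → R) :
    (∏ j ∈ s, (Polynomial.C (z j) + Polynomial.X * Polynomial.C (w j)) ^ e j).natDegree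
        ≤ ∑ j ∈ s, e j ∧
      (∏ j ∈ s, (Polynomial.C (z j) + Polynomial.X * Polynomial.C (w j)) ^ e j).coeff
        (∑ j ∈ s, e j) = ∏ j ∈ s, w j ^ e j := by
  classical
  have hlin : ∀ j, (Polynomial.C (z j) + Polynomial.X * Polynomial.C (w j)).natDegree ≤ 1 := by
    intro j
    compute_degree
  have hpow : ∀ j, ((Polynomial.C (z j) + Polynomial.X * Polynomial.C (w j)) ^ e j).natDegree
      ≤ e j := fun j => by
    simpa using Polynomial.natDegree_pow_le_of_le (e j) (hlin j)
  induction s using Finset.induction_on with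
  | empty => simp
  | insert i s hi ih =>
    rw [Finset.prod_insert hi, Finset.sum_insert hi, Finset.prod_insert hi]
    refine ⟨Polynomial.natDegree_mul_le_of_le (hpow i) ih.1, ?_⟩
    rw [Polynomial.coeff_mul_add_eq_of_natDegree_le (hpow i) ih.1, ih.2]
    congr 1
    have := Polynomial.coeff_pow_of_natDegree_le (m := e i) (hlin i)
    rw [mul_one] at this
    rw [this]
    simp [Polynomial.coeff_C]

/-- The restriction of a homogeneous polynomial of degree `m` to the line `z + t w` is a
polynomial in `t` of degree at most `m` with `t ^ m`-coefficient `B(w)`. -/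
theorem exists_polynomial_line {B : MvPolynomial σ R} (hB : B.IsHomogeneous m) (z w : σ → R) :
    ∃ p : Polynomial R, p.natDegree ≤ m ∧ p.coeff m = eval w B ∧
      ∀ t, p.eval t = eval (z + t • w) B := by
  refine ⟨∑ s ∈ B.support, Polynomial.C (B.coeff s) *
    ∏ j ∈ s.support, (Polynomial.C (z j) + Polynomial.X * Polynomial.C (w j)) ^ s j, ?_, ?_, ?_⟩
  · refine Polynomial.natDegree_sum_le_of_forall_le _ _ fun s hs => ?_
    refine (Polynomial.natDegree_C_mul_le _ _).trans ?_
    refine (natDegree_coeff_prod_line s.support s z w).1.trans ?_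
    rw [hB.degree_eq_sum_deg_support hs]
  · rw [Polynomial.finsetSum_coeff, eval_eq]
    refine Finset.sum_congr rfl fun s hs => ?_
    rw [Polynomial.coeff_C_mul, hB.degree_eq_sum_deg_support hs,
      (natDegree_coeff_prod_line s.support s z w).2]
  · intro t
    rw [Polynomial.eval_finsetSum, eval_eq]
    refine Finset.sum_congr rfl fun s hs => ?_
    simp [Polynomial.eval_prod, mul_comm t]

end Homogeneous

/-- If all roots of `r ↦ B(z + r w)` are at distance at least `ρ` from `t`, then `B(z + t w)` is
bounded below by `|B(w)| ρ ^ m`. -/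
theorem le_norm_eval_line {σ : Type*} {m : ℕ} {B : MvPolynomial σ ℂ} (hB : B.IsHomogeneous m)
    {z w : σ → ℂ} (hw : eval w B ≠ 0) {t : ℂ} {ρ : ℝ} (hρ : 0 ≤ ρ)
    (h : ∀ r, eval (z + r • w) B = 0 → ρ ≤ ‖t - r‖) :
    ‖eval w B‖ * ρ ^ m ≤ ‖eval (z + t • w) B‖ := by
  obtain ⟨p, hdeg, hcoeff, hp⟩ := exists_polynomial_line hB z w
  have hpm : p.natDegree = m :=
    le_antisymm hdeg (Polynomial.le_natDegree_of_ne_zero (hcoeff ▸ hw))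
  have hlead : p.leadingCoeff = eval w B := by
    rw [Polynomial.leadingCoeff, hpm, hcoeff]
  have hsplit := IsAlgClosed.splits p
  have hcard : p.roots.card = m := by rw [← hsplit.natDegree_eq_card_roots, hpm]
  rw [← hp t, hsplit.eval_eq_prod_roots, hlead, norm_mul]
  refine mul_le_mul_of_nonneg_left ?_ (norm_nonneg _)
  have hroots : ∀ r ∈ p.roots, ρ ≤ ‖t - r‖ := fun r hr => h r (by
    rw [← hp r]; exact Polynomial.isRoot_of_mem_roots hr)
  rw [← hcard]
  clear hcard
  generalize p.roots = s at hroots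
  induction s using Multiset.induction_on with
  | empty => simp
  | cons a s ih =>
    simp only [Multiset.mem_cons, forall_eq_or_imp] at hroots
    rw [Multiset.map_cons, Multiset.prod_cons, Multiset.card_cons, pow_succ', norm_mul]
    exact mul_le_mul hroots.1 (ih hroots.2) (by positivity) (norm_nonneg _)

theorem isOpen_setOf_forall_ne_zero {X Y : Type*} [TopologicalSpace X] [TopologicalSpace Y]
    {K : Set Y} (hK : IsCompact K) {E : Type*} [TopologicalSpace E] [T1Space E] [Zero E]
    {G : X → Y → E} (hG : Continuous fun q : X × Y => G q.1 q.2) :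
    IsOpen {x | ∀ y ∈ K, G x y ≠ 0} := by
  rw [isOpen_iff_mem_nhds]
  intro x hx
  refine hK.eventually_forall_of_forall_eventually fun y hy => ?_
  exact hG.continuousAt.eventually_ne (hx y hy)

variable {d m : ℕ} {A : MvPolynomial (Fin d) ℝ} {v : Fin d → ℝ}

/-- The complex vector with the given real coordinates. -/
def toComplex (x : Fin d → ℝ) : Fin d → ℂ := fun j => x j

/-- Evaluation of a real polynomial at a complex vector. -/
noncomputable def evalC (A : MvPolynomial (Fin d) ℝ) (z : Fin d → ℂ) : ℂ :=
  eval z (A.map (algebraMap ℝ ℂ))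

theorem evalC_toComplex (A : MvPolynomial (Fin d) ℝ) (x : Fin d → ℝ) :
    evalC A (toComplex x) = (eval x A : ℝ) := by
  have := eval₂_comp_left (algebraMap ℝ ℂ) (RingHom.id ℝ) x A
  rw [evalC, eval_map, ← RingHom.comp_id (algebraMap ℝ ℂ)]
  exact this.symm

theorem evalC_toComplex_ne_zero {x : Fin d → ℝ} : evalC A (toComplex x) ≠ 0 ↔ eval x A ≠ 0 := by
  rw [evalC_toComplex]
  exact Complex.ofReal_ne_zero

theorem toComplex_add_smul (x w : Fin d → ℝ) (t : ℝ) :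
    toComplex (x + t • w) = toComplex x + (t : ℂ) • toComplex w := by
  ext j
  simp [toComplex]

theorem evalC_smul (hA : A.IsHomogeneous m) (c : ℂ) (z : Fin d → ℂ) :
    evalC A (c • z) = c ^ m * evalC A z :=
  eval_smul_of_isHomogeneous (hA.map _) c z

theorem continuous_evalC (A : MvPolynomial (Fin d) ℝ) : Continuous (evalC A) :=
  MvPolynomial.continuous_eval _

@[fun_prop]
theorem continuous_toComplex : Continuous (toComplex (d := d)) := by
  unfold toComplex
  fun_prop

theorem im_eq_zero_of_root (hv : RealHyperbolicDir A v) {x : Fin d → ℝ} {t : ℂ}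
    (h : evalC A (toComplex x + t • toComplex v) = 0) : t.im = 0 :=
  hv.2 x t h

/-- The cone of points `x` such that `A` does not vanish on the convex cone spanned by `x` and
`v`, apart from the origin. -/
def rootCone (A : MvPolynomial (Fin d) ℝ) (v : Fin d → ℝ) : Set (Fin d → ℝ) :=
  {x | ∀ p q : ℝ, 0 ≤ p → 0 ≤ q → 0 < p + q → eval (p • x + q • v) A ≠ 0}

theorem eval_ne_zero_of_mem_rootCone {x : Fin d → ℝ} (hx : x ∈ rootCone A v) :
    eval x A ≠ 0 := by
  simpa using hx 1 0 zero_le_one le_rfl (by norm_num)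

theorem self_mem_rootCone (hA : A.IsHomogeneous m) (hv : eval v A ≠ 0) : v ∈ rootCone A v := by
  intro p q _ _ hpq
  rw [← add_smul, eval_smul_of_isHomogeneous hA]
  exact mul_ne_zero (pow_ne_zero _ hpq.ne') hv

theorem re_neg_of_root (hv : RealHyperbolicDir A v) {x : Fin d → ℝ} (hx : x ∈ rootCone A v)
    {t : ℂ} (h : evalC A (toComplex x + t • toComplex v) = 0) : t.re < 0 := by
  have ht : (t.re : ℂ) = t := Complex.ext rfl (by simp [im_eq_zero_of_root hv h])
  by_contra! hre
  refine evalC_toComplex_ne_zero.2 (hx 1 t.re zero_le_one hre (by linarith)) ?_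
  rw [one_smul, toComplex_add_smul, ht, h]

theorem mem_rootCone_of_forall_nonneg (hA : A.IsHomogeneous m) (hv : eval v A ≠ 0)
    {x : Fin d → ℝ} (h : ∀ t : ℝ, 0 ≤ t → eval (x + t • v) A ≠ 0) : x ∈ rootCone A v := by
  intro p q hp hq hpq
  rcases hp.eq_or_lt with rfl | hp
  · rw [zero_smul, zero_add, eval_smul_of_isHomogeneous hA]
    exact mul_ne_zero (pow_ne_zero _ (by linarith)) hv
  · have : p • x + q • v = p • (x + (q / p) • v) := by
      rw [smul_add, smul_smul, mul_div_cancel₀ _ hp.ne']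
    rw [this, eval_smul_of_isHomogeneous hA]
    exact mul_ne_zero (pow_ne_zero _ hp.ne') (h _ (by positivity))

theorem smul_mem_rootCone {x : Fin d → ℝ} (hx : x ∈ rootCone A v) {c : ℝ} (hc : 0 < c) :
    c • x ∈ rootCone A v := by
  intro p q hp hq hpq
  rw [smul_smul]
  refine hx _ _ (by positivity) hq ?_
  rcases hp.eq_or_lt with rfl | hp
  · simpa using hpq
  · positivity

theorem add_self_mem_rootCone {x : Fin d → ℝ} (hx : x ∈ rootCone A v) :
    v + x ∈ rootCone A v := by
  intro p q hp hq hpq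
  have : p • (v + x) + q • v = p • x + (p + q) • v := by module
  rw [this]
  exact hx _ _ hp (by positivity) (by linarith)

theorem isPreconnected_rootCone (hA : A.IsHomogeneous m) (hv : eval v A ≠ 0) :
    IsPreconnected (rootCone A v) := by
  have hstar : StarConvex ℝ v (rootCone A v) := by
    intro x hx a b ha hb hab p q hp hq hpq
    have : p • (a • v + b • x) + q • v = (p * b) • x + (p * a + q) • v := by module
    rw [this]
    refine hx _ _ (by positivity) (by positivity) ?_
    have : p * b + (p * a + q) = p * (a + b) + q := by ring
    rw [this, hab, mul_one]
    exact hpq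
  exact (hstar.isPathConnected (self_mem_rootCone hA hv)).isConnected.isPreconnected

theorem isOpen_rootCone (hA : A.IsHomogeneous m) : IsOpen (rootCone A v) := by
  have : rootCone A v =
      {x | ∀ s ∈ Set.Icc (0 : ℝ) 1, eval (s • x + (1 - s) • v) A ≠ 0} := by
    ext x
    refine ⟨fun hx s hs => hx _ _ hs.1 (by linarith [hs.2]) (by linarith), ?_⟩
    intro hx p q hp hq hpq
    have : p • x + q • v = (p + q) • ((p / (p + q)) • x + (1 - p / (p + q)) • v) := by
      rw [smul_add, smul_smul, smul_smul]
      congr 2 <;> field_simp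
      ring
    rw [this, eval_smul_of_isHomogeneous hA]
    refine mul_ne_zero (pow_ne_zero _ hpq.ne') (hx _ ⟨by positivity, ?_⟩)
    rw [div_le_one hpq]
    linarith
  rw [this]
  refine isOpen_setOf_forall_ne_zero isCompact_Icc ?_
  exact (MvPolynomial.continuous_eval A).comp (by fun_prop)

theorem mem_rootCone_of_mem_closure (hA : A.IsHomogeneous m) (hv : RealHyperbolicDir A v)
    {x : Fin d → ℝ} (hx : x ∈ closure (rootCone A v)) (hxA : eval x A ≠ 0) :
    x ∈ rootCone A v := by
  have hbound : ∀ t : ℝ, 0 ≤ t → ∀ y ∈ closure (rootCone A v),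
      ‖evalC A (toComplex v)‖ * t ^ m ≤ ‖evalC A (toComplex y + (t : ℂ) • toComplex v)‖ := by
    intro t ht
    refine closure_minimal ?_ (isClosed_le continuous_const
      ((continuous_evalC A).comp (by fun_prop)).norm)
    intro y hy
    refine le_norm_eval_line (hA.map _) (evalC_toComplex_ne_zero.2 hv.1) ht fun r hr => ?_
    have hre := re_neg_of_root hv hy hr
    refine le_trans ?_ ((le_abs_self _).trans (Complex.abs_re_le_norm _))
    rw [Complex.sub_re, Complex.ofReal_re]
    linarith
  refine mem_rootCone_of_forall_nonneg hA hv.1 fun t ht => ?_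
  rcases ht.eq_or_lt with rfl | ht
  · simpa using hxA
  · rw [← evalC_toComplex_ne_zero, ← norm_pos_iff]
    have h1 := hbound t ht.le x hx
    rw [toComplex_add_smul]
    have h3 : 0 < ‖evalC A (toComplex v)‖ := norm_pos_iff.2 (evalC_toComplex_ne_zero.2 hv.1)
    exact lt_of_lt_of_le (by positivity) h1

/-- For `a` in the cone, `A` has no zeros of the form `x + i v + t a` with `x` real and
`t` in the closed upper half plane. -/
theorem evalC_add_I_smul_ne_zero (hA : A.IsHomogeneous m) (hv : RealHyperbolicDir A v)
    {a : Fin d → ℝ} (ha : a ∈ rootCone A v) (x : Fin d → ℝ) {t : ℂ} (ht : 0 ≤ t.im) :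
    evalC A (toComplex x + Complex.I • toComplex v + t • toComplex a) ≠ 0 := by
  have haA : evalC A (toComplex a) ≠ 0 :=
    evalC_toComplex_ne_zero.2 (eval_ne_zero_of_mem_rootCone ha)
  set S : Set (Fin d → ℝ) := {x | ∀ t : ℂ, 0 ≤ t.im →
    evalC A (toComplex x + Complex.I • toComplex v + t • toComplex a) ≠ 0} with hS
  have hzero : (0 : Fin d → ℝ) ∈ S := by
    intro t ht h
    have h0 : toComplex (0 : Fin d → ℝ) = 0 := by ext j; simp [toComplex]
    rw [h0, zero_add] at h
    by_cases ht0 : t = 0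
    · rw [ht0, zero_smul, add_zero, evalC_smul hA] at h
      exact mul_ne_zero (pow_ne_zero _ Complex.I_ne_zero) (evalC_toComplex_ne_zero.2 hv.1) h
    · have h1 : Complex.I • toComplex v + t • toComplex a
          = t • (toComplex a + (Complex.I / t) • toComplex v) := by
        rw [smul_add, smul_smul, mul_div_cancel₀ _ ht0, add_comm]
      rw [h1, evalC_smul hA] at h
      have h2 := (mul_eq_zero.1 h).resolve_left (pow_ne_zero _ ht0)
      have him := im_eq_zero_of_root hv h2
      have hre := re_neg_of_root hv ha h2
      have hs : ((Complex.I / t).re : ℂ) * t = Complex.I := by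
        rw [show ((Complex.I / t).re : ℂ) = Complex.I / t from Complex.ext rfl (by simp [him]),
          div_mul_cancel₀ _ ht0]
      have him' := congrArg Complex.im hs
      rw [Complex.im_ofReal_mul, Complex.I_im] at him'
      nlinarith
  have hopen : IsOpen S := by
    set K : Set (ℝ × ℂ) := Metric.sphere 0 1 ∩ {y | 0 ≤ y.1 ∧ 0 ≤ y.2.im} with hK
    have hKc : IsCompact K := (isCompact_sphere _ _).inter_right
      ((isClosed_le continuous_const continuous_fst).inter
        (isClosed_le continuous_const (Complex.continuous_im.comp continuous_snd)))
    have hSK : S = {x | ∀ y ∈ K, evalC A ((y.1 : ℂ) • (toComplex x + Complex.I • toComplex v)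
        + y.2 • toComplex a) ≠ 0} := by
      ext x
      constructor
      · rintro hx ⟨p, q⟩ ⟨hpq, hp, hq⟩
        dsimp only at hp hq ⊢
        rcases hp.eq_or_lt with rfl | hp
        · have hq0 : q ≠ 0 := by
            rintro rfl
            simp at hpq
          simp only [Complex.ofReal_zero, zero_smul, zero_add]
          rw [evalC_smul hA]
          exact mul_ne_zero (pow_ne_zero _ hq0) haA
        · have hpC : (p : ℂ) ≠ 0 := Complex.ofReal_ne_zero.2 hp.ne'
          have h1 : (p : ℂ) • (toComplex x + Complex.I • toComplex v) + q • toComplex a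
              = (p : ℂ) • (toComplex x + Complex.I • toComplex v + (q / p) • toComplex a) := by
            rw [smul_add (p : ℂ) (_ + _), smul_smul, mul_div_cancel₀ _ hpC]
          rw [h1, evalC_smul hA]
          refine mul_ne_zero (pow_ne_zero _ hpC) (hx _ ?_)
          rw [Complex.div_ofReal_im]
          positivity
      · intro hx t ht h
        have hN : (0 : ℝ) < ‖((1 : ℝ), t)‖ := norm_pos_iff.2 (by simp)
        set N := ‖((1 : ℝ), t)‖ with hNdef
        refine hx (N⁻¹ • ((1 : ℝ), t)) ⟨?_, ?_, ?_⟩ ?_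
        · rw [mem_sphere_zero_iff_norm, norm_smul, ← hNdef, norm_inv, Real.norm_of_nonneg hN.le,
            inv_mul_cancel₀ hN.ne']
        · simp only [Prod.smul_fst, smul_eq_mul, mul_one]
          positivity
        · simp only [Prod.smul_snd, Complex.smul_im, smul_eq_mul]
          positivity
        · have h1 : (((N⁻¹ • ((1 : ℝ), t)).1 : ℝ) : ℂ) •
                (toComplex x + Complex.I • toComplex v) + (N⁻¹ • ((1 : ℝ), t)).2 • toComplex a
              = ((N⁻¹ : ℝ) : ℂ) •
                (toComplex x + Complex.I • toComplex v + t • toComplex a) := by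
            ext j
            simp
            ring
          rw [h1, evalC_smul hA, h, mul_zero]
    rw [hSK]
    refine isOpen_setOf_forall_ne_zero hKc ?_
    exact (continuous_evalC A).comp (by fun_prop)
  have hbound : ∀ t : ℂ, 0 ≤ t.im → ∀ y ∈ closure S, ‖evalC A (toComplex a)‖ * t.im ^ m ≤
      ‖evalC A (toComplex y + Complex.I • toComplex v + t • toComplex a)‖ := by
    intro t ht
    refine closure_minimal ?_ (isClosed_le continuous_const
      ((continuous_evalC A).comp (by fun_prop)).norm)
    intro y hy
    refine le_norm_eval_line (hA.map _) haA ht fun r hr => ?_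
    have hr0 : r.im < 0 := by
      by_contra! hr0
      exact hy r hr0 hr
    refine le_trans ?_ ((le_abs_self _).trans (Complex.abs_im_le_norm _))
    rw [Complex.sub_im]
    linarith
  have hclosed : IsClosed S := by
    refine isClosed_of_closure_subset fun y hy t ht => ?_
    rcases ht.eq_or_lt with ht0 | ht0
    · intro h
      have h1 : toComplex y + Complex.I • toComplex v + t • toComplex a
          = toComplex (y + t.re • a) + Complex.I • toComplex v := by
        have : t = (t.re : ℂ) := Complex.ext rfl (by simp [← ht0])
        rw [toComplex_add_smul, ← this, add_right_comm]
      rw [h1] at h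
      simpa using im_eq_zero_of_root hv h
    · have := hbound t ht y hy
      rw [← norm_pos_iff]
      have h3 : 0 < ‖evalC A (toComplex a)‖ := norm_pos_iff.2 haA
      exact lt_of_lt_of_le (by positivity) this
  have huniv : S = Set.univ := IsClopen.eq_univ ⟨hclosed, hopen⟩ ⟨0, hzero⟩
  have hx : x ∈ S := huniv ▸ Set.mem_univ x
  exact hx t ht

/-- `A` is hyperbolic in every direction of the cone. -/
theorem realHyperbolicDir_of_mem_rootCone (hA : A.IsHomogeneous m)
    (hv : RealHyperbolicDir A v) {a : Fin d → ℝ} (ha : a ∈ rootCone A v) :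
    RealHyperbolicDir A a := by
  have haA : evalC A (toComplex a) ≠ 0 :=
    evalC_toComplex_ne_zero.2 (eval_ne_zero_of_mem_rootCone ha)
  have hupper : ∀ (x : Fin d → ℝ) (t : ℂ), 0 < t.im →
      evalC A (toComplex x + t • toComplex a) ≠ 0 := by
    intro x t ht
    have hbound : ∀ e ∈ Set.Ioi (0 : ℝ), ‖evalC A (toComplex a)‖ * t.im ^ m ≤
        ‖evalC A (toComplex x + ((e : ℂ) * Complex.I) • toComplex v + t • toComplex a)‖ := by
      intro e he
      have he0 : (0 : ℝ) < e := he
      have heC : (e : ℂ) ≠ 0 := Complex.ofReal_ne_zero.2 he0.ne'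
      refine le_norm_eval_line (hA.map _) haA ht.le fun r hr => ?_
      have hr0 : r.im < 0 := by
        by_contra! hr0
        have h1 : toComplex x + ((e : ℂ) * Complex.I) • toComplex v + r • toComplex a
            = (e : ℂ) • (toComplex (e⁻¹ • x) + Complex.I • toComplex v
              + (r / e) • toComplex a) := by
          ext j
          simp [toComplex]
          field_simp
        change evalC A _ = 0 at hr
        rw [h1, evalC_smul hA] at hr
        refine evalC_add_I_smul_ne_zero hA hv ha (e⁻¹ • x) ?_
          ((mul_eq_zero.1 hr).resolve_left (pow_ne_zero _ heC))
        rw [Complex.div_ofReal_im]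
        positivity
      refine le_trans ?_ ((le_abs_self _).trans (Complex.abs_im_le_norm _))
      rw [Complex.sub_im]
      linarith
    have h0 := closure_minimal (t := {e : ℝ | ‖evalC A (toComplex a)‖ * t.im ^ m ≤
        ‖evalC A (toComplex x + ((e : ℂ) * Complex.I) • toComplex v + t • toComplex a)‖}) hbound
      (isClosed_le continuous_const ((continuous_evalC A).comp (by fun_prop)).norm)
      (show (0 : ℝ) ∈ closure (Set.Ioi 0) by rw [closure_Ioi]; exact Set.self_mem_Ici)
    simp only [Set.mem_ofPred_eq, Complex.ofReal_zero, zero_mul, zero_smul, add_zero] at h0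
    rw [← norm_pos_iff]
    have h3 : 0 < ‖evalC A (toComplex a)‖ := norm_pos_iff.2 haA
    exact lt_of_lt_of_le (by positivity) h0
  refine ⟨eval_ne_zero_of_mem_rootCone ha, fun x t h => ?_⟩
  change evalC A (toComplex x + t • toComplex a) = 0 at h
  rcases lt_trichotomy t.im 0 with hneg | h0 | hpos
  · refine absurd ?_ (hupper (-x) (-t) (by simpa using hneg))
    have h1 : toComplex (-x) + (-t) • toComplex a
        = (-1 : ℂ) • (toComplex x + t • toComplex a) := by
      ext j
      simp [toComplex]
      ring
    rw [h1, evalC_smul hA, h, mul_zero]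
  · exact h0
  · exact absurd h (hupper x t hpos)

theorem isOpen_setOf_realHyperbolicDir (hA : A.IsHomogeneous m) :
    IsOpen {u : Fin d → ℝ | RealHyperbolicDir A u} := by
  rw [isOpen_iff_mem_nhds]
  intro u hu
  exact Filter.mem_of_superset ((isOpen_rootCone hA).mem_nhds (self_mem_rootCone hA hu.1))
    fun a ha => realHyperbolicDir_of_mem_rootCone hA hu ha

theorem connectedComponentIn_eq_rootCone (hA : A.IsHomogeneous m)
    (hv : RealHyperbolicDir A v) :
    connectedComponentIn {u : Fin d → ℝ | RealHyperbolicDir A u} v = rootCone A v := by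
  have hvC := self_mem_rootCone hA hv.1
  refine Set.Subset.antisymm ?_ ?_
  · refine isPreconnected_connectedComponentIn.subset_of_closure_inter_subset
      (isOpen_rootCone hA) ⟨v, mem_connectedComponentIn hv, hvC⟩ ?_
    rintro x ⟨hx, hxK⟩
    exact mem_rootCone_of_mem_closure hA hv hx (connectedComponentIn_subset _ _ hxK).1
  · exact (isPreconnected_rootCone hA hv.1).subset_connectedComponentIn hvC
      fun a ha => realHyperbolicDir_of_mem_rootCone hA hv ha

theorem rootCone_eq_of_mem (hA : A.IsHomogeneous m) (hv : RealHyperbolicDir A v)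
    {a : Fin d → ℝ} (ha : a ∈ rootCone A v) : rootCone A a = rootCone A v := by
  rw [← connectedComponentIn_eq_rootCone hA hv,
    ← connectedComponentIn_eq_rootCone hA (realHyperbolicDir_of_mem_rootCone hA hv ha)]
  rw [← connectedComponentIn_eq_rootCone hA hv] at ha
  exact (connectedComponentIn_eq ha).symm

theorem eval_mul_eval_pos_of_mem_rootCone (hA : A.IsHomogeneous m) (hv : eval v A ≠ 0)
    {x : Fin d → ℝ} (hx : x ∈ rootCone A v) : 0 < eval v A * eval x A := by
  have hvC := self_mem_rootCone hA hv
  by_contra! hneg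
  obtain ⟨y, hy, hy0⟩ := (isPreconnected_rootCone hA hv).intermediate_value hx hvC
    (f := fun y => eval v A * eval y A)
    (continuous_const.mul (MvPolynomial.continuous_eval A)).continuousOn
    (show (0 : ℝ) ∈ Set.Icc _ _ from ⟨hneg, mul_self_nonneg _⟩)
  exact mul_ne_zero hv (eval_ne_zero_of_mem_rootCone hy) hy0

end HyperbolicityCone

open HyperbolicityCone in
/-- properties of the cone of hyperbolicity of a real homogeneous
hyperbolic polynomial: the set of hyperbolic directions is open, the connected
component of `v` is a convex cone, a fixed nonzero multiple of `A` is positive on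
the component and vanishes on its boundary, and for `x` in the component all roots
of `t ↦ A(x + tv)` are real and negative. -/
theorem hyperbolicity_cone_properties {d m : ℕ} (hm : 1 ≤ m)
    (A : MvPolynomial (Fin d) ℝ) (hA : A.IsHomogeneous m)
    (v : Fin d → ℝ) (hv : RealHyperbolicDir A v) :
    IsOpen {u : Fin d → ℝ | RealHyperbolicDir A u} ∧
    (∀ a ∈ connectedComponentIn {u : Fin d → ℝ | RealHyperbolicDir A u} v,
      ∀ b ∈ connectedComponentIn {u : Fin d → ℝ | RealHyperbolicDir A u} v,
        a + b ∈ connectedComponentIn {u : Fin d → ℝ | RealHyperbolicDir A u} v) ∧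
    (∀ a ∈ connectedComponentIn {u : Fin d → ℝ | RealHyperbolicDir A u} v,
      ∀ lam : ℝ, 0 < lam →
        lam • a ∈ connectedComponentIn {u : Fin d → ℝ | RealHyperbolicDir A u} v) ∧
    (∃ c : ℝ, c ≠ 0 ∧
      (∀ x ∈ connectedComponentIn {u : Fin d → ℝ | RealHyperbolicDir A u} v,
        0 < c * eval x A) ∧
      (∀ x ∈ frontier (connectedComponentIn {u : Fin d → ℝ | RealHyperbolicDir A u} v),
        c * eval x A = 0)) ∧
    (∀ x ∈ connectedComponentIn {u : Fin d → ℝ | RealHyperbolicDir A u} v,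
      ∀ t : ℂ,
        eval (fun j => (x j : ℂ) + t * (v j : ℂ)) (A.map (algebraMap ℝ ℂ)) = 0 →
          t.im = 0 ∧ t.re < 0) := by
  have hK := connectedComponentIn_eq_rootCone hA hv
  refine ⟨isOpen_setOf_realHyperbolicDir hA, ?_⟩
  rw [hK]
  refine ⟨fun a ha b hb => ?_, fun a ha lam hlam => smul_mem_rootCone ha hlam,
    ⟨eval v A, hv.1, fun x hx => eval_mul_eval_pos_of_mem_rootCone hA hv.1 hx, ?_⟩, ?_⟩
  · rw [← rootCone_eq_of_mem hA hv ha] at hb ⊢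
    exact add_self_mem_rootCone hb
  · rintro x ⟨hx, hxi⟩
    rw [(isOpen_rootCone hA).interior_eq] at hxi
    by_contra hne
    exact hxi (mem_rootCone_of_mem_closure hA hv hx (right_ne_zero_of_mul hne))
  · intro x hx t ht
    exact ⟨hv.2 x t ht, re_neg_of_root hv hx ht⟩
end

section
/- Let A be a real homogeneous polynomial of degree m ≥ 1 in d variables, hyperbolic in some direction, and let B be a cone of hyperbolicity of A, i.e. a connected component of the set of directions of hyperbolicity of A. For y ∈ ℝ^d define K^{A,B}(y) := ℝ^d if A(y) ≠ 0, and otherwise K^{A,B}(y) := the connected component of the set of directions of hyperbolicity of hom(A, y) that contains B. Then the assignment y ↦ K^{A,B}(y) is lower semicontinuous: for every y ∈ ℝ^d and every u ∈ K^{A,B}(y) there is an open neighborhood N of y such that u ∈ K^{A,B}(y') for all y' ∈ N. -/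
open MvPolynomial

/-- The polynomial `w ↦ A(y + w)`. -/
noncomputable def translateR {d : ℕ} (A : MvPolynomial (Fin d) ℝ) (y : Fin d → ℝ) :
    MvPolynomial (Fin d) ℝ :=
  bind₁ (fun j => C (y j) + X j) A

/-- The leading homogeneous part `hom(A, y)`: the homogeneous component of minimal
degree of `w ↦ A(y + w)`. -/
noncomputable def homPart {d : ℕ} (A : MvPolynomial (Fin d) ℝ) (y : Fin d → ℝ) :
    MvPolynomial (Fin d) ℝ :=
  homogeneousComponent
    (sInf {n : ℕ | homogeneousComponent n (translateR A y) ≠ 0}) (translateR A y)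

/-- Membership in the cone `K^{A,B}(y)`: all of `ℝ^d` if `A(y) ≠ 0`, otherwise the
connected component of the hyperbolicity directions of `hom(A, y)` containing `B`. -/
def KMem {d : ℕ} (A : MvPolynomial (Fin d) ℝ) (B : Set (Fin d → ℝ))
    (y u : Fin d → ℝ) : Prop :=
  eval y A ≠ 0 ∨
    (eval y A = 0 ∧ ∃ w ∈ B,
      u ∈ connectedComponentIn {v : Fin d → ℝ | RealHyperbolicDir (homPart A y) v} w)

open scoped Topology

/-- The complex vector with the given real coordinates. -/
noncomputable def complexify {d : ℕ} (x : Fin d → ℝ) : Fin d → ℂ := fun j => (x j : ℂ)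

@[simp] lemma complexify_apply {d : ℕ} (x : Fin d → ℝ) (j : Fin d) :
    complexify x j = (x j : ℂ) := rfl

lemma continuous_complexify {d : ℕ} : Continuous (complexify (d := d)) := by
  unfold complexify; fun_prop

lemma continuous_mvAeval {d : ℕ} (A : MvPolynomial (Fin d) ℝ) :
    Continuous fun w : Fin d → ℂ => aeval w A := by
  simp only [aeval_def, ← eval_map]
  exact MvPolynomial.continuous_eval _

lemma aeval_complexify {d : ℕ} (A : MvPolynomial (Fin d) ℝ) (x : Fin d → ℝ) :
    aeval (complexify x) A = ((eval x A : ℝ) : ℂ) := by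
  have h := aeval_algebraMap_apply ℂ x A
  rw [aeval_eq_eval] at h
  exact h

lemma MvPolynomial.IsHomogeneous.aeval_smul_vec {d n : ℕ} {A : MvPolynomial (Fin d) ℝ}
    (hA : A.IsHomogeneous n) (c : ℂ) (w : Fin d → ℂ) :
    MvPolynomial.aeval (c • w) A = c ^ n * MvPolynomial.aeval w A := by
  simp only [MvPolynomial.aeval_def, MvPolynomial.eval₂_eq', Finset.mul_sum]
  refine Finset.sum_congr rfl fun s hs => ?_
  have hdeg : ∑ i, s i = n := by
    rw [← Finsupp.degree_eq_sum, Finsupp.degree_eq_weight_one]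
    exact hA (mem_support_iff.mp hs)
  simp only [Pi.smul_apply, smul_eq_mul, mul_pow, Finset.prod_mul_distrib,
    Finset.prod_pow_eq_pow_sum, hdeg]
  ring

/-- A polynomial without zeros in a disc grows in a controlled way away from its center. -/
lemma Polynomial.norm_eval_le_of_ne_zero {f : Polynomial ℂ} {n : ℕ} (hn : f.natDegree ≤ n)
    {R : ℝ} (hR : 0 < R) (hf : ∀ s : ℂ, ‖s‖ < R → f.eval s ≠ 0) (s : ℂ) :
    ‖f.eval s‖ ≤ ‖f.eval 0‖ * (1 + ‖s‖ / R) ^ n := by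
  have hsplit : f.Splits := IsAlgClosed.splits f
  have hroots : ∀ a ∈ f.roots, R ≤ ‖a‖ := fun a ha => by
    by_contra! h
    exact hf a h (Polynomial.isRoot_of_mem_roots ha)
  have hone : 1 ≤ 1 + ‖s‖ / R := by
    have : 0 ≤ ‖s‖ / R := by positivity
    linarith
  have hprod : ∀ M : Multiset ℂ, (∀ a ∈ M, R ≤ ‖a‖) →
      ‖(M.map (s - ·)).prod‖ ≤ ‖(M.map ((0 : ℂ) - ·)).prod‖ * (1 + ‖s‖ / R) ^ M.card := by
    intro M
    induction M using Multiset.induction with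
    | empty => simp
    | cons a M ih =>
      intro h
      have ha := h a (Multiset.mem_cons_self a M)
      have ih' := ih fun b hb => h b (Multiset.mem_cons_of_mem hb)
      simp only [Multiset.map_cons, Multiset.prod_cons, norm_mul, Multiset.card_cons]
      have h1 : ‖s - a‖ ≤ ‖(0 : ℂ) - a‖ * (1 + ‖s‖ / R) := by
        rw [zero_sub, norm_neg]
        have h2 : ‖s‖ ≤ ‖a‖ * (‖s‖ / R) := by
          calc ‖s‖ = R * (‖s‖ / R) := by field_simp
            _ ≤ _ := by gcongr
        linarith [norm_sub_le s a]
      calc _ ≤ (‖(0 : ℂ) - a‖ * (1 + ‖s‖ / R)) *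
            (‖(M.map ((0 : ℂ) - ·)).prod‖ * (1 + ‖s‖ / R) ^ M.card) := by gcongr
        _ = _ := by ring
  rw [hsplit.eval_eq_prod_roots, hsplit.eval_eq_prod_roots, norm_mul, norm_mul, mul_assoc]
  gcongr
  refine (hprod _ hroots).trans ?_
  gcongr
  exact (Polynomial.card_roots' f).trans hn

lemma norm_aeval_line_le {d : ℕ} (A : MvPolynomial (Fin d) ℝ) (w ξ : Fin d → ℂ) {R : ℝ}
    (hR : 0 < R) (h : ∀ s : ℂ, ‖s‖ < R → aeval (w + s • ξ) A ≠ 0) (s : ℂ) :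
    ‖aeval (w + s • ξ) A‖ ≤ ‖aeval w A‖ * (1 + ‖s‖ / R) ^ A.totalDegree := by
  set f : Polynomial ℂ :=
    aeval (fun j => Polynomial.C (ξ j) * Polynomial.X + Polynomial.C (w j))
      (A.map (algebraMap ℝ ℂ)) with hf
  have hev : ∀ s : ℂ, f.eval s = aeval (w + s • ξ) A := fun s => by
    have h1 := comp_aeval_apply (fun j => Polynomial.C (ξ j) * Polynomial.X + Polynomial.C (w j))
      (Polynomial.aeval s : Polynomial ℂ →ₐ[ℂ] ℂ) (A.map (algebraMap ℝ ℂ))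
    rw [Polynomial.coe_aeval_eq_eval] at h1
    rw [hf, h1, aeval_map_algebraMap]
    congr 2
    ext j
    simp
    ring
  have hdeg : f.natDegree ≤ A.totalDegree := by
    have := aeval_natDegree_le (m := A.totalDegree) (n := 1) (A.map (algebraMap ℝ ℂ))
      (Finset.sup_mono (support_map_subset _ A))
      (fun j => Polynomial.C (ξ j) * Polynomial.X + Polynomial.C (w j))
      fun j => Polynomial.natDegree_linear_le
    rwa [mul_one] at this
  have h0 : f.eval 0 = aeval w A := by simpa using hev 0
  rw [← hev, ← h0]
  exact Polynomial.norm_eval_le_of_ne_zero hdeg hR (fun s hs => hev s ▸ h s hs) s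

/-- `A` has no zeros on the tube `ℝ^d + i v`. -/
def NonvanishingTube {d : ℕ} (A : MvPolynomial (Fin d) ℝ) (v : Fin d → ℝ) : Prop :=
  ∀ x : Fin d → ℝ, aeval (complexify x + Complex.I • complexify v) A ≠ 0

lemma NonvanishingTube.aeval_ne_zero {d n : ℕ} {A : MvPolynomial (Fin d) ℝ}
    (hA : A.IsHomogeneous n) {v : Fin d → ℝ} (hv : NonvanishingTube A v) (x : Fin d → ℝ)
    {t : ℂ} (ht : t.im ≠ 0) : aeval (complexify x + t • complexify v) A ≠ 0 := by
  have h : complexify x + t • complexify v = (t.im : ℂ) •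
      (complexify (t.im⁻¹ • (x + t.re • v)) + Complex.I • complexify v) := by
    have ht' : (t.im : ℂ) ≠ 0 := by exact_mod_cast ht
    ext j
    simp
    field_simp
    conv_lhs => rw [← Complex.re_add_im t]
    ring
  rw [h, hA.aeval_smul_vec]
  exact mul_ne_zero (pow_ne_zero _ (by exact_mod_cast ht)) (hv _)

lemma NonvanishingTube.eval_ne_zero {d n : ℕ} {A : MvPolynomial (Fin d) ℝ}
    (hA : A.IsHomogeneous n) {v : Fin d → ℝ} (hv : NonvanishingTube A v) : eval v A ≠ 0 := by
  intro h
  apply hv 0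
  have : complexify (0 : Fin d → ℝ) + Complex.I • complexify v = Complex.I • complexify v := by
    ext j; simp
  rw [this, hA.aeval_smul_vec, aeval_complexify, h]
  simp

lemma realHyperbolicDir_iff {d n : ℕ} {A : MvPolynomial (Fin d) ℝ} (hA : A.IsHomogeneous n)
    (v : Fin d → ℝ) : RealHyperbolicDir A v ↔ NonvanishingTube A v := by
  have key : ∀ (x : Fin d → ℝ) (t : ℂ),
      eval (fun j => (x j : ℂ) + t * (v j : ℂ)) (A.map (algebraMap ℝ ℂ)) =
        aeval (complexify x + t • complexify v) A := fun x t => by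
    rw [eval_map, aeval_def]
    rfl
  simp only [RealHyperbolicDir, key]
  constructor
  · rintro ⟨-, h⟩ x hx
    simpa using h x _ hx
  · intro h
    refine ⟨h.eval_ne_zero hA, fun x t hx => ?_⟩
    by_contra ht
    exact h.aeval_ne_zero hA x ht hx

lemma aeval_translateR {d : ℕ} (A : MvPolynomial (Fin d) ℝ) (y : Fin d → ℝ) (w : Fin d → ℂ) :
    aeval w (translateR A y) = aeval (complexify y + w) A := by
  rw [translateR, aeval_bind₁]
  congr 2
  ext j
  simp

/-- The order of vanishing of `A` at `y`. -/
noncomputable def homOrder {d : ℕ} (A : MvPolynomial (Fin d) ℝ) (y : Fin d → ℝ) : ℕ :=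
  sInf {n : ℕ | homogeneousComponent n (translateR A y) ≠ 0}

lemma homPart_isHomogeneous {d : ℕ} (A : MvPolynomial (Fin d) ℝ) (y : Fin d → ℝ) :
    (homPart A y).IsHomogeneous (homOrder A y) :=
  homogeneousComponent_isHomogeneous _ _

lemma homPart_ne_zero {d : ℕ} {A : MvPolynomial (Fin d) ℝ} (hA : A ≠ 0) (y : Fin d → ℝ) :
    homPart A y ≠ 0 := by
  refine Nat.sInf_mem (s := {n : ℕ | homogeneousComponent n (translateR A y) ≠ 0}) ?_
  by_contra! h
  have hT : translateR A y = 0 := by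
    rw [← sum_homogeneousComponent (translateR A y)]
    refine Finset.sum_eq_zero fun n _ => ?_
    by_contra hn
    exact (Set.eq_empty_iff_forall_notMem.mp h) n hn
  apply hA
  refine MvPolynomial.funext fun x => ?_
  have h1 := aeval_translateR A y (complexify (x - y))
  have h2 : complexify y + complexify (x - y) = complexify x := by ext j; simp
  rw [hT, h2, map_zero, aeval_complexify] at h1
  rw [map_zero]
  exact_mod_cast h1.symm

/-- Expansion of `A` near `y` with leading term `homPart A y`. -/
lemma exists_homPart_expansion {d : ℕ} (A : MvPolynomial (Fin d) ℝ) (y : Fin d → ℝ) :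
    ∃ G : ℂ → (Fin d → ℂ) → ℂ, Continuous (fun q : ℂ × (Fin d → ℂ) => G q.1 q.2) ∧
      (∀ w, G 0 w = aeval w (homPart A y)) ∧
      ∀ ρ w, aeval (complexify y + ρ • w) A = ρ ^ homOrder A y * G ρ w := by
  set T := translateR A y with hT
  set p := homOrder A y with hp
  have hlow : ∀ n < p, homogeneousComponent n T = 0 := fun n hn => by
    by_contra h
    exact absurd (Nat.sInf_le (s := {n : ℕ | homogeneousComponent n T ≠ 0}) h) (not_le.mpr hn)
  refine ⟨fun ρ w => ∑ k ∈ Finset.range (T.totalDegree + 1),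
    ρ ^ k * aeval w (homogeneousComponent (p + k) T), ?_, fun w => ?_, fun ρ w => ?_⟩
  · refine continuous_finsetSum _ fun k _ => ?_
    exact (continuous_fst.pow k).mul ((continuous_mvAeval _).comp continuous_snd)
  · beta_reduce
    rw [Finset.sum_range_succ']
    simp [homPart, hp, homOrder, hT]
  · rw [← aeval_translateR, ← hT]
    have hsum : T = ∑ n ∈ Finset.range (p + (T.totalDegree + 1)), homogeneousComponent n T := by
      conv_lhs => rw [← sum_homogeneousComponent T]
      refine Finset.sum_subset (fun n hn => ?_) fun n _ hn => ?_
      · simp only [Finset.mem_range] at hn ⊢; omega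
      · apply homogeneousComponent_eq_zero
        simp only [Finset.mem_range] at hn; omega
    conv_lhs => rw [hsum]
    rw [Finset.sum_range_add, Finset.sum_eq_zero (fun n hn => hlow n (Finset.mem_range.mp hn)),
      zero_add, map_sum, Finset.mul_sum]
    refine Finset.sum_congr rfl fun k _ => ?_
    rw [(homogeneousComponent_isHomogeneous _ _).aeval_smul_vec, pow_add, mul_assoc]

lemma homPart_zero {d n : ℕ} {A : MvPolynomial (Fin d) ℝ} (hA : A.IsHomogeneous n)
    (hA0 : A ≠ 0) : homPart A 0 = A := by
  have hT : translateR A 0 = A := by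
    refine MvPolynomial.funext fun x => ?_
    have h := aeval_translateR A 0 (complexify x)
    have h2 : complexify 0 + complexify x = complexify x := by ext j; simp
    rw [h2, aeval_complexify, aeval_complexify] at h
    exact_mod_cast h
  have hset : {k : ℕ | homogeneousComponent k A ≠ 0} = {n} := by
    ext k
    simp only [Set.mem_ofPred_eq, Set.mem_singleton_iff]
    rw [homogeneousComponent_of_mem hA]
    simp [hA0, eq_comm]
  rw [homPart, hT, hset, csInf_singleton, homogeneousComponent_of_mem hA, if_pos rfl]

lemma eval_smul_ne_zero {d n : ℕ} {A : MvPolynomial (Fin d) ℝ} (hA : A.IsHomogeneous n)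
    {c : ℝ} (hc : c ≠ 0) {x : Fin d → ℝ} : eval (c • x) A ≠ 0 ↔ eval x A ≠ 0 := by
  have h := hA.aeval_smul_vec (c : ℂ) (complexify x)
  have h2 : (c : ℂ) • complexify x = complexify (c • x) := by ext j; simp
  rw [h2, aeval_complexify, aeval_complexify] at h
  have h3 : eval (c • x) A = c ^ n * eval x A := by exact_mod_cast h
  rw [h3]
  simp [hc]

/-- `A` has no zeros on the segment from `v` to `u`. -/
def NonvanishingSegment {d : ℕ} (A : MvPolynomial (Fin d) ℝ) (v u : Fin d → ℝ) : Prop :=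
  ∀ c ∈ Set.Icc (0 : ℝ) 1, eval (c • u + (1 - c) • v) A ≠ 0

lemma isOpen_nonvanishingSegment {d : ℕ} (A : MvPolynomial (Fin d) ℝ) (v : Fin d → ℝ) :
    IsOpen {u | NonvanishingSegment A v u} := by
  rw [isOpen_iff_mem_nhds]
  intro u hu
  refine isCompact_Icc.eventually_forall_of_forall_eventually fun c hc => ?_
  have hcont : Continuous fun q : (Fin d → ℝ) × ℝ => eval (q.2 • q.1 + (1 - q.2) • v) A :=
    A.continuous_eval.comp (by fun_prop)
  exact hcont.continuousAt.eventually_ne (hu c hc)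

lemma nonvanishingSegment_iff {d n : ℕ} {A : MvPolynomial (Fin d) ℝ} (hA : A.IsHomogeneous n)
    {v : Fin d → ℝ} (hv : eval v A ≠ 0) (u : Fin d → ℝ) :
    NonvanishingSegment A v u ↔ ∀ r : ℝ, 0 ≤ r → eval (u + r • v) A ≠ 0 := by
  constructor
  · intro h r hr
    have hr1 : 0 < 1 + r := by linarith
    have h1 := h (1 + r)⁻¹ ⟨by positivity, inv_le_one_of_one_le₀ (by linarith)⟩
    rw [← eval_smul_ne_zero hA hr1.ne'] at h1
    convert h1 using 3
    ext j
    simp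
    field_simp
    ring
  · intro h c hc
    rcases hc.1.eq_or_lt with rfl | hc0
    · simpa using hv
    have h1 := h ((1 - c) / c) (div_nonneg (by linarith [hc.2]) hc.1)
    rw [← eval_smul_ne_zero hA hc0.ne'] at h1
    convert h1 using 3
    ext j
    simp
    field_simp

lemma NonvanishingSegment.self {d : ℕ} {A : MvPolynomial (Fin d) ℝ} {v : Fin d → ℝ}
    (hv : eval v A ≠ 0) : NonvanishingSegment A v v := by
  intro c _
  rw [← add_smul]
  simpa using hv

lemma NonvanishingSegment.exists_sub_smul {d : ℕ} {A : MvPolynomial (Fin d) ℝ}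
    {v u : Fin d → ℝ} (h : NonvanishingSegment A v u) :
    ∃ ε > (0 : ℝ), NonvanishingSegment A v (u - ε • v) := by
  have hcont : Continuous fun ε : ℝ => u - ε • v := by fun_prop
  have h1 : ∀ᶠ ε : ℝ in 𝓝 0, NonvanishingSegment A v (u - ε • v) :=
    hcont.continuousAt.eventually_mem
      ((isOpen_nonvanishingSegment A v).mem_nhds (by simpa using h))
  obtain ⟨ε, h2, h3⟩ :=
    ((h1.filter_mono (nhdsWithin_le_nhds (s := Set.Ioi 0))).and self_mem_nhdsWithin).exists
  exact ⟨ε, h3, h2⟩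

lemma NonvanishingSegment.aeval_ne_zero {d n : ℕ} {A : MvPolynomial (Fin d) ℝ}
    (hA : A.IsHomogeneous n) {v u : Fin d → ℝ} (hv : NonvanishingTube A v)
    (hu : NonvanishingSegment A v u) {a : ℂ} {b : ℝ} (ha : 0 ≤ a.im) (hb : 0 ≤ b)
    (hab : (a, b) ≠ 0) :
    aeval (a • complexify u + (Complex.I * b) • complexify v) A ≠ 0 := by
  have hv0 := hv.eval_ne_zero hA
  by_cases ha0 : a = 0
  · have hb0 : b ≠ 0 := fun hb0 => hab (by simp [ha0, hb0])
    rw [ha0, zero_smul, zero_add, hA.aeval_smul_vec, aeval_complexify]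
    refine mul_ne_zero (pow_ne_zero _ ?_) (by exact_mod_cast hv0)
    simp [hb0]
  · have h1 : a • complexify u + (Complex.I * b) • complexify v =
        a • (complexify u + (Complex.I * b / a) • complexify v) := by
      ext j
      simp
      field_simp
    rw [h1, hA.aeval_smul_vec]
    refine mul_ne_zero (pow_ne_zero _ ha0) ?_
    by_cases hc : (Complex.I * b / a).im = 0
    · obtain ⟨r, hr⟩ : ∃ r : ℝ, Complex.I * b / a = r :=
        ⟨_, Complex.ext rfl (by simpa using hc)⟩
      have hra : Complex.I * b = r * a := by rw [← hr]; field_simp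
      have him : b = r * a.im := by simpa using congrArg Complex.im hra
      have hr0 : 0 ≤ r := by
        by_contra! hneg
        have hb0 : b = 0 := by nlinarith
        rw [hb0] at hr
        have : r = 0 := by simpa using hr.symm
        linarith
      have h2 : complexify u + (r : ℂ) • complexify v = complexify (u + r • v) := by
        ext j; simp
      rw [hr, h2, aeval_complexify]
      exact_mod_cast (nonvanishingSegment_iff hA hv0 u).1 hu r hr0
    · exact hv.aeval_ne_zero hA u hc

/-- If `a u + i b v` avoids the zeros of the leading part of `A` at `y` for `Im a, b ≥ 0`, then
`A` has no zeros at the points `z + s u + t v` for `z` real near `y` and `s`, `t` small in the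
upper half plane. -/
lemma NonvanishingTube.exists_local_aeval_ne_zero {d n : ℕ} {A : MvPolynomial (Fin d) ℝ}
    (hA : A.IsHomogeneous n) {v : Fin d → ℝ} (hv : NonvanishingTube A v) (y u : Fin d → ℝ)
    (hu : ∀ (a : ℂ) (b : ℝ), 0 ≤ a.im → 0 ≤ b → (a, b) ≠ 0 →
      aeval (a • complexify u + (Complex.I * b) • complexify v) (homPart A y) ≠ 0) :
    ∃ δ > (0 : ℝ), ∀ z : Fin d → ℝ, ‖z - y‖ < δ → ∀ s t : ℂ, 0 ≤ s.im → ‖s‖ < δ →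
      0 < t.im → ‖t‖ < δ →
      aeval (complexify z + s • complexify u + t • complexify v) A ≠ 0 := by
  obtain ⟨G, hGc, hG0, hG⟩ := exists_homPart_expansion A y
  set F : ((Fin d → ℝ) × ℂ) → ℂ → ℂ := fun q s =>
    aeval (complexify q.1 + s • complexify u + q.2 • complexify v) A with hF
  have hFc : Continuous fun q : ((Fin d → ℝ) × ℂ) × ℂ => F q.1 q.2 :=
    (continuous_mvAeval A).comp (by have := continuous_complexify (d := d); fun_prop)
  have hFc1 : ∀ s, Continuous fun q => F q s := fun s =>
    (continuous_mvAeval A).comp (by have := continuous_complexify (d := d); fun_prop)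
  obtain ⟨δ₀, hδ₀, hcone⟩ : ∃ δ₀ > (0 : ℝ), ∀ (s : ℂ) (τ : ℝ), 0 ≤ s.im → 0 ≤ τ →
      (s, τ) ≠ 0 → ‖(s, τ)‖ < δ₀ → F (y, Complex.I * τ) s ≠ 0 := by
    set K : Set (ℂ × ℝ) := Metric.sphere 0 1 ∩ {k | 0 ≤ k.1.im ∧ 0 ≤ k.2} with hK
    have hKc : IsCompact K := by
      refine (isCompact_sphere _ _).inter_right (IsClosed.inter ?_ ?_)
      · exact isClosed_le continuous_const (Complex.continuous_im.comp continuous_fst)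
      · exact isClosed_le continuous_const continuous_snd
    have hev : ∀ᶠ ρ : ℝ in 𝓝 0, ∀ k ∈ K,
        G ρ (k.1 • complexify u + (Complex.I * k.2) • complexify v) ≠ 0 := by
      refine hKc.eventually_forall_of_forall_eventually fun k hk => ?_
      have hcont : Continuous fun q : ℝ × (ℂ × ℝ) =>
          G q.1 (q.2.1 • complexify u + (Complex.I * q.2.2) • complexify v) :=
        hGc.comp (Continuous.prodMk
          (Complex.continuous_ofReal.comp continuous_fst) (by fun_prop))
      refine hcont.continuousAt.eventually_ne ?_
      simp only [Complex.ofReal_zero, hG0]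
      refine hu _ _ hk.2.1 hk.2.2 fun h0 => ?_
      have hk1 : ‖k‖ = 1 := by simpa using hk.1
      rw [show k = 0 from h0] at hk1
      simp at hk1
    obtain ⟨δ₀, hδ₀, hball⟩ := Metric.eventually_nhds_iff.1 hev
    refine ⟨δ₀, hδ₀, fun s τ hs hτ hne hlt => ?_⟩
    set ρ := ‖(s, τ)‖ with hρ
    have hρ0 : 0 < ρ := norm_pos_iff.2 hne
    have hρ0' : (ρ : ℂ) ≠ 0 := by exact_mod_cast hρ0.ne'
    have hmem : (ρ⁻¹ • (s, τ) : ℂ × ℝ) ∈ K := by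
      refine ⟨?_, ?_, ?_⟩
      · simp only [mem_sphere_zero_iff_norm, norm_smul, norm_inv, Real.norm_eq_abs,
          abs_of_pos hρ0, ← hρ]
        field_simp
      · simpa using mul_nonneg (inv_nonneg.2 hρ0.le) hs
      · exact mul_nonneg (inv_nonneg.2 hρ0.le) hτ
    have h1 := hball (y := ρ) (by simpa [abs_of_pos hρ0] using hlt) _ hmem
    have h2 := hG (ρ : ℂ) ((ρ⁻¹ • (s, τ) : ℂ × ℝ).1 • complexify u +
      (Complex.I * (ρ⁻¹ • (s, τ) : ℂ × ℝ).2) • complexify v)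
    have h3 : complexify y + s • complexify u + (Complex.I * τ) • complexify v =
        complexify y + (ρ : ℂ) • ((ρ⁻¹ • (s, τ) : ℂ × ℝ).1 • complexify u +
          (Complex.I * (ρ⁻¹ • (s, τ) : ℂ × ℝ).2) • complexify v) := by
      ext j
      simp
      field_simp
      ring
    simp only [hF, h3, h2]
    exact mul_ne_zero (pow_ne_zero _ hρ0') h1
  set δ₁ := δ₀ / 2 with hδ₁
  have hδ₁0 : 0 < δ₁ := by positivity
  have hhalf : IsClosed {s : ℂ | 0 ≤ s.im} := isClosed_le continuous_const Complex.continuous_im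
  have hev : ∀ᶠ q : (Fin d → ℝ) × ℂ in 𝓝 (y, 0),
      ∀ s ∈ Metric.sphere (0 : ℂ) δ₁ ∩ {s | 0 ≤ s.im}, F q s ≠ 0 := by
    refine ((isCompact_sphere _ _).inter_right hhalf).eventually_forall_of_forall_eventually
      fun s hs => ?_
    refine hFc.continuousAt.eventually_ne ?_
    have hs1 : ‖s‖ = δ₁ := by simpa using hs.1
    have := hcone s 0 hs.2 le_rfl (fun h => by
      have : s = 0 := congrArg Prod.fst h
      rw [this, norm_zero] at hs1
      linarith) (by simp [hs1, hδ₁0.le]; linarith)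
    simpa using this
  obtain ⟨η, hη, hball⟩ := Metric.eventually_nhds_iff_ball.1 hev
  set η' := min η δ₁ with hη'
  have hη'0 : 0 < η' := lt_min hη hδ₁0
  set Q : Set ((Fin d → ℝ) × ℂ) := Metric.ball (y, 0) η' ∩ {q | 0 < q.2.im} with hQ
  have hQconv : Convex ℝ Q := by
    refine (convex_ball _ _).inter ?_
    exact convex_halfSpace_gt (f := fun q : (Fin d → ℝ) × ℂ => q.2.im)
      ⟨fun _ _ => by simp, fun _ _ => by simp⟩ 0
  set E : Set ℂ := Metric.closedBall 0 δ₁ ∩ {s | 0 ≤ s.im} with hE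
  have hEc : IsCompact E := (isCompact_closedBall _ _).inter_right hhalf
  set W : Set ((Fin d → ℝ) × ℂ) := {q | ∀ s ∈ E, F q s ≠ 0} with hW
  have hWo : IsOpen W := by
    rw [isOpen_iff_mem_nhds]
    intro q hq
    exact hEc.eventually_forall_of_forall_eventually fun s hs =>
      hFc.continuousAt.eventually_ne (hq s hs)
  have hne : (Q ∩ W).Nonempty := by
    refine ⟨(y, Complex.I * (η' / 2 : ℝ)), ⟨?_, ?_⟩, fun s hs => ?_⟩
    · simp only [Metric.mem_ball, dist_eq_norm, Prod.mk_sub_mk, sub_self, sub_zero, Prod.norm_mk,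
        norm_zero, norm_mul, Complex.norm_I, one_mul, Complex.norm_real, Real.norm_eq_abs,
        abs_of_pos (half_pos hη'0)]
      exact max_lt hη'0 (half_lt_self hη'0)
    · simp only [Set.mem_ofPred_eq, Complex.I_mul_im, Complex.ofReal_re]
      positivity
    · refine hcone s (η' / 2) hs.2 (by positivity) (fun h => ?_) ?_
      · have : η' / 2 = 0 := congrArg Prod.snd h
        linarith
      · have hs1 : ‖s‖ ≤ δ₁ := by simpa using hs.1
        rw [Prod.norm_mk, Real.norm_eq_abs, abs_of_pos (half_pos hη'0)]
        have : η' ≤ δ₁ := min_le_right _ _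
        exact max_lt (by linarith) (by linarith)
  have hcl : closure W ∩ Q ⊆ W := by
    rintro ⟨z, t⟩ ⟨hqW, hqQ⟩ s hs h0
    have ht : 0 < t.im := hqQ.2
    have hreal : ∀ r : ℝ, F (z, t) r ≠ 0 := fun r => by
      have h1 : complexify z + (r : ℂ) • complexify u = complexify (z + r • u) := by
        ext j; simp
      simp only [hF, h1]
      exact hv.aeval_ne_zero hA _ ht.ne'
    have hsim : 0 < s.im := by
      refine lt_of_le_of_ne hs.2 fun h => hreal s.re ?_
      rwa [show (s.re : ℂ) = s from Complex.ext rfl (by simpa using h)]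
    have hsn : ‖s‖ < δ₁ := by
      have hs1 : ‖s‖ ≤ δ₁ := by simpa using hs.1
      refine lt_of_le_of_ne hs1 fun h => ?_
      exact hball _ (Metric.ball_subset_ball (min_le_left _ _) hqQ.1) s
        ⟨by simpa using h, hs.2⟩ h0
    set R := min s.im (δ₁ - ‖s‖) with hR
    have hR0 : 0 < R := lt_min hsim (by linarith)
    have hclosed : IsClosed {q | ‖F q 0‖ ≤ ‖F q s‖ * (1 + ‖-s‖ / R) ^ A.totalDegree} :=
      isClosed_le (hFc1 0).norm ((hFc1 s).norm.mul continuous_const)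
    have hsub : W ⊆ {q | ‖F q 0‖ ≤ ‖F q s‖ * (1 + ‖-s‖ / R) ^ A.totalDegree} := by
      intro q hq
      have hshift : ∀ s' : ℂ, complexify q.1 + s • complexify u + q.2 • complexify v +
          s' • complexify u =
          complexify q.1 + (s + s') • complexify u + q.2 • complexify v := fun s' => by
        rw [add_smul]; abel
      have h1 := norm_aeval_line_le A
        (complexify q.1 + s • complexify u + q.2 • complexify v) (complexify u) hR0
        (fun s' hs' => by
          rw [hshift]
          refine hq (s + s') ⟨?_, ?_⟩
          · have := norm_add_le s s'
            have := hs'.trans_le (min_le_right _ _)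
            simp only [Metric.mem_closedBall, dist_zero_right]
            linarith
          · have h2 := (abs_le.1 (Complex.abs_im_le_norm s')).1
            have := hs'.trans_le (min_le_left _ _)
            simp only [Set.mem_ofPred_eq, Complex.add_im]
            linarith) (-s)
      rw [hshift, add_neg_cancel] at h1
      exact h1
    have h2 : ‖F (z, t) 0‖ ≤ ‖F (z, t) s‖ * (1 + ‖-s‖ / R) ^ A.totalDegree :=
      closure_minimal hsub hclosed hqW
    rw [h0, norm_zero, zero_mul] at h2
    exact hreal 0 (by simpa using h2)
  have hQW : Q ⊆ W := hQconv.isPreconnected.subset_of_closure_inter_subset hWo hne hcl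
  refine ⟨η', hη'0, fun z hz s t hs hsn ht htn => ?_⟩
  refine hQW (show ((z, t) : (Fin d → ℝ) × ℂ) ∈ Q from ⟨?_, ht⟩) s ⟨?_, hs⟩
  · simp only [Metric.mem_ball, dist_eq_norm, Prod.mk_sub_mk, sub_zero, Prod.norm_mk]
    exact max_lt hz htn
  · simpa using (hsn.trans_le (min_le_right _ _)).le

/-- Gårding: the directions visible from a hyperbolicity direction are hyperbolicity directions. -/
lemma NonvanishingSegment.nonvanishingTube {d n : ℕ} {A : MvPolynomial (Fin d) ℝ}
    (hA : A.IsHomogeneous n) {v u : Fin d → ℝ} (hv : NonvanishingTube A v)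
    (hu : NonvanishingSegment A v u) : NonvanishingTube A u := by
  have hA0 : A ≠ 0 := by
    rintro rfl
    exact hv 0 (map_zero _)
  obtain ⟨ε, hε, hu'⟩ := hu.exists_sub_smul
  obtain ⟨δ, hδ, h⟩ := hv.exists_local_aeval_ne_zero hA 0 (u - ε • v) (by
    rw [homPart_zero hA hA0]
    exact fun a b ha hb hab => hu'.aeval_ne_zero hA hv ha hb hab)
  intro x hx
  set c := δ / (2 * (1 + ‖x‖ + ε)) with hc
  have hc0 : 0 < c := by positivity
  have hcδ : c + c * ‖x‖ + c * ε = δ / 2 := by rw [hc]; field_simp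
  have hcx : 0 ≤ c * ‖x‖ := by positivity
  have hcε : 0 < c * ε := by positivity
  refine h (c • x) ?_ (c * Complex.I) (c * ε * Complex.I) ?_ ?_ ?_ ?_ ?_
  · rw [sub_zero, norm_smul, Real.norm_eq_abs, abs_of_pos hc0]; linarith
  · simpa using hc0.le
  · simp only [norm_mul, Complex.norm_I, Complex.norm_real, Real.norm_eq_abs, abs_of_pos hc0]
    linarith
  · simpa using hcε
  · simp only [norm_mul, Complex.norm_I, Complex.norm_real, Real.norm_eq_abs, abs_of_pos hc0,
      abs_of_pos hε]
    linarith
  · have : complexify (c • x) + ((c : ℂ) * Complex.I) • complexify (u - ε • v) +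
        ((c : ℂ) * ε * Complex.I) • complexify v =
        (c : ℂ) • (complexify x + Complex.I • complexify u) := by
      ext j; simp; ring
    rw [this, hA.aeval_smul_vec, hx, mul_zero]

lemma NonvanishingSegment.mem_connectedComponentIn {d n : ℕ} {A : MvPolynomial (Fin d) ℝ}
    (hA : A.IsHomogeneous n) {v u : Fin d → ℝ} (hv : NonvanishingTube A v)
    (hu : NonvanishingSegment A v u) :
    u ∈ connectedComponentIn {w | NonvanishingTube A w} v := by
  refine (convex_segment v u).isPreconnected.subset_connectedComponentIn
    (left_mem_segment ℝ v u) ?_ (right_mem_segment ℝ v u)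
  rintro w ⟨a, b, ha, hb, hab, rfl⟩
  refine NonvanishingSegment.nonvanishingTube hA hv fun c hc => ?_
  convert hu (c * b) ⟨mul_nonneg hc.1 hb, mul_le_one₀ hc.2 hb (by linarith)⟩ using 3
  obtain rfl : a = 1 - b := by linarith
  ext j
  simp
  ring

lemma NonvanishingSegment.of_mem_closure {d n : ℕ} {A : MvPolynomial (Fin d) ℝ}
    (hA : A.IsHomogeneous n) {v u : Fin d → ℝ} (hv : NonvanishingTube A v)
    (hu : u ∈ closure {w | NonvanishingSegment A v w}) (hu0 : eval u A ≠ 0) :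
    NonvanishingSegment A v u := by
  have hv0 := hv.eval_ne_zero hA
  rw [nonvanishingSegment_iff hA hv0]
  intro r hr h0
  have hr0 : 0 < r := by
    refine hr.lt_of_ne ?_
    rintro rfl
    exact hu0 (by simpa using h0)
  have hclosed : IsClosed {w : Fin d → ℝ | ‖eval w A‖ ≤
      ‖eval (w + r • v) A‖ * (1 + ‖(-r : ℂ)‖ / r) ^ A.totalDegree} :=
    isClosed_le A.continuous_eval.norm
      (((A.continuous_eval.comp (by fun_prop)).norm).mul continuous_const)
  have hsub : {w | NonvanishingSegment A v w} ⊆ {w : Fin d → ℝ | ‖eval w A‖ ≤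
      ‖eval (w + r • v) A‖ * (1 + ‖(-r : ℂ)‖ / r) ^ A.totalDegree} := by
    intro w hw
    have h1 := norm_aeval_line_le A (complexify (w + r • v)) (complexify v) hr0
      (fun s hs => by
        by_cases hs0 : s.im = 0
        · obtain ⟨q, rfl⟩ : ∃ q : ℝ, s = q := ⟨s.re, Complex.ext rfl (by simpa using hs0)⟩
          have h2 : complexify (w + r • v) + (q : ℂ) • complexify v =
              complexify (w + (r + q) • v) := by
            ext j; simp; ring
          rw [h2, aeval_complexify]
          have hq : |q| < r := by simpa using hs
          exact_mod_cast (nonvanishingSegment_iff hA hv0 w).1 hw (r + q)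
            (by linarith [(abs_lt.1 hq).1])
        · exact hv.aeval_ne_zero hA _ hs0) (-r)
    have h2 : complexify (w + r • v) + (-r : ℂ) • complexify v = complexify w := by
      ext j; simp
    rw [h2, aeval_complexify, aeval_complexify, Complex.norm_real, Complex.norm_real] at h1
    exact h1
  have h3 := closure_minimal hsub hclosed hu
  simp only [Set.mem_ofPred_eq, h0, norm_zero, zero_mul] at h3
  exact hu0 (by simpa using h3)

lemma nonvanishingSegment_of_mem_connectedComponentIn {d n : ℕ} {A : MvPolynomial (Fin d) ℝ}
    (hA : A.IsHomogeneous n) {v u : Fin d → ℝ} (hv : NonvanishingTube A v)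
    (hu : u ∈ connectedComponentIn {w | NonvanishingTube A w} v) :
    NonvanishingSegment A v u := by
  have hv0 := hv.eval_ne_zero hA
  refine isPreconnected_connectedComponentIn.subset_of_closure_inter_subset
    (isOpen_nonvanishingSegment A v)
    ⟨v, _root_.mem_connectedComponentIn hv, NonvanishingSegment.self hv0⟩ ?_ hu
  rintro w ⟨hw, hwc⟩
  exact NonvanishingSegment.of_mem_closure hA hv hw
    (NonvanishingTube.eval_ne_zero hA (connectedComponentIn_subset _ _ hwc))

lemma norm_aeval_homPart_le {d : ℕ} {A : MvPolynomial (Fin d) ℝ} {y : Fin d → ℝ}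
    {w w' : Fin d → ℂ} {C : ℝ}
    (h : ∀ᶠ τ : ℝ in 𝓝[>] 0, ‖aeval (complexify y + (τ : ℂ) • w') A‖ ≤
      ‖aeval (complexify y + (τ : ℂ) • w) A‖ * C) :
    ‖aeval w' (homPart A y)‖ ≤ ‖aeval w (homPart A y)‖ * C := by
  obtain ⟨G, hGc, hG0, hG⟩ := exists_homPart_expansion A y
  have hlim : ∀ w : Fin d → ℂ,
      Filter.Tendsto (fun τ : ℝ => ‖G τ w‖) (𝓝[>] 0) (𝓝 ‖aeval w (homPart A y)‖) := fun w => by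
    have hcont : Continuous fun τ : ℝ => G τ w :=
      hGc.comp (Continuous.prodMk Complex.continuous_ofReal continuous_const)
    refine (hcont.norm.tendsto' _ _ ?_).mono_left nhdsWithin_le_nhds
    simp [hG0]
  refine le_of_tendsto_of_tendsto (hlim w') ((hlim w).mul_const C) ?_
  filter_upwards [h, self_mem_nhdsWithin] with τ hτ hτ0
  have hτ0' : 0 < ‖(τ : ℂ) ^ homOrder A y‖ := by
    have : (τ : ℂ) ≠ 0 := by exact_mod_cast (ne_of_gt hτ0)
    exact norm_pos_iff.2 (pow_ne_zero _ this)
  rw [hG, hG, norm_mul, norm_mul, mul_assoc] at hτ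
  exact le_of_mul_le_mul_left hτ hτ0'

/-- Hyperbolicity directions of `A` are hyperbolicity directions of its leading parts. -/
lemma NonvanishingTube.nonvanishingTube_homPart {d n : ℕ} {A : MvPolynomial (Fin d) ℝ}
    (hA : A.IsHomogeneous n) {v : Fin d → ℝ} (hv : NonvanishingTube A v) (y : Fin d → ℝ) :
    NonvanishingTube (homPart A y) v := by
  have hA0 : A ≠ 0 := by
    rintro rfl
    exact hv 0 (map_zero _)
  intro x hx
  have hall : ∀ ξ : Fin d → ℂ,
      aeval (complexify x + Complex.I • complexify v + ξ) (homPart A y) = 0 := by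
    intro ξ
    have hcont : Continuous fun s : ℂ => v + fun j => (s * ξ j).im := by fun_prop
    have hnear : ∀ᶠ s : ℂ in 𝓝 0, NonvanishingSegment A v (v + fun j => (s * ξ j).im) := by
      refine hcont.continuousAt.eventually_mem
        ((isOpen_nonvanishingSegment A v).mem_nhds ?_)
      have h0 : (v + fun j => ((0 : ℂ) * ξ j).im) = v := by ext j; simp
      rw [h0]
      exact NonvanishingSegment.self (hv.eval_ne_zero hA)
    obtain ⟨R, hR, hball⟩ := Metric.eventually_nhds_iff.1 hnear
    have hle := norm_aeval_homPart_le (A := A) (y := y)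
      (w := complexify x + Complex.I • complexify v)
      (w' := complexify x + Complex.I • complexify v + ξ)
      (C := (1 + ‖(1 : ℂ)‖ / R) ^ A.totalDegree) (by
        filter_upwards [self_mem_nhdsWithin] with τ hτ
        have h1 := norm_aeval_line_le A
          (complexify y + (τ : ℂ) • (complexify x + Complex.I • complexify v))
          ((τ : ℂ) • ξ) hR (fun s hs => by
            have h2 : complexify y + (τ : ℂ) • (complexify x + Complex.I • complexify v) +
                s • (τ : ℂ) • ξ =
                complexify (y + τ • (x + fun j => (s * ξ j).re)) +
                  (τ * Complex.I) • complexify (v + fun j => (s * ξ j).im) := by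
              ext j
              have h3 := Complex.re_add_im (s * ξ j)
              simp only [Pi.add_apply, Pi.smul_apply, smul_eq_mul, complexify_apply,
                Complex.ofReal_add, Complex.ofReal_mul]
              linear_combination (-(τ : ℂ)) * h3
            rw [h2]
            refine NonvanishingTube.aeval_ne_zero hA
              ((hball (by simpa using hs)).nonvanishingTube hA hv) _ ?_
            simpa using ne_of_gt hτ) 1
        rwa [one_smul, add_assoc, ← smul_add] at h1)
    rw [hx, norm_zero, zero_mul] at hle
    simpa using hle
  apply homPart_ne_zero hA0 y
  refine MvPolynomial.funext fun x' => ?_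
  have h1 := hall (complexify x' - (complexify x + Complex.I • complexify v))
  rw [add_sub_cancel, aeval_complexify] at h1
  rw [map_zero]
  exact_mod_cast h1

/-- lower semicontinuity of the family of cones `K^{A,B}(y)` for a
real homogeneous hyperbolic polynomial `A` and a cone of hyperbolicity `B`. -/
theorem KAB_lower_semicontinuous {d m : ℕ} (hm : 1 ≤ m)
    (A : MvPolynomial (Fin d) ℝ) (hA : A.IsHomogeneous m)
    (v₀ : Fin d → ℝ) (hv₀ : RealHyperbolicDir A v₀)
    (B : Set (Fin d → ℝ))
    (hB : B = connectedComponentIn {v : Fin d → ℝ | RealHyperbolicDir A v} v₀) :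
    ∀ y u : Fin d → ℝ, KMem A B y u →
      ∃ N : Set (Fin d → ℝ), IsOpen N ∧ y ∈ N ∧ ∀ y' ∈ N, KMem A B y' u := by
  intro y u hu
  have hset : ∀ z, {v | RealHyperbolicDir (homPart A z) v} =
      {v | NonvanishingTube (homPart A z) v} := fun z =>
    Set.ext fun v => realHyperbolicDir_iff (homPart_isHomogeneous A z) v
  rcases hu with hy | ⟨-, w, hwB, hu⟩
  · exact ⟨{z | eval z A ≠ 0}, isOpen_ne_fun A.continuous_eval continuous_const, hy,
      fun z hz => Or.inl hz⟩
  have hw : NonvanishingTube A w := by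
    rw [hB] at hwB
    have hwA : w ∈ {v | RealHyperbolicDir A v} := connectedComponentIn_subset _ _ hwB
    exact (realHyperbolicDir_iff hA w).1 hwA
  rw [hset] at hu
  have hHw := hw.nonvanishingTube_homPart hA y
  have hHom := homPart_isHomogeneous A y
  obtain ⟨ε, hε, hu'⟩ :=
    (nonvanishingSegment_of_mem_connectedComponentIn hHom hHw hu).exists_sub_smul
  obtain ⟨δ, hδ, hloc⟩ := hw.exists_local_aeval_ne_zero hA y (u - ε • w)
    fun a b ha hb hab => hu'.aeval_ne_zero hHom hHw ha hb hab
  refine ⟨Metric.ball y δ, Metric.isOpen_ball, Metric.mem_ball_self hδ, fun z hz => ?_⟩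
  by_cases hz0 : eval z A = 0
  swap
  · exact Or.inl hz0
  refine Or.inr ⟨hz0, w, hwB, ?_⟩
  rw [hset]
  have hPw := hw.nonvanishingTube_homPart hA z
  have hPom := homPart_isHomogeneous A z
  refine NonvanishingSegment.mem_connectedComponentIn hPom hPw ?_
  rw [nonvanishingSegment_iff hPom (hPw.eval_ne_zero hPom)]
  intro r hr h0
  have hle := norm_aeval_homPart_le (A := A) (y := z)
    (w := Complex.I • complexify (u + r • w))
    (w' := Complex.I • complexify (u + r • w) + complexify w)
    (C := (1 + ‖(1 : ℂ)‖ / ε) ^ A.totalDegree) (by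
      have hsmall : ∀ᶠ τ : ℝ in 𝓝[>] 0, τ * (1 + r + 2 * ε) < δ := by
        have hcont : Continuous fun τ : ℝ => τ * (1 + r + 2 * ε) := by fun_prop
        exact (hcont.tendsto' 0 0 (by simp)).mono_left nhdsWithin_le_nhds |>.eventually_lt_const hδ
      filter_upwards [hsmall, self_mem_nhdsWithin] with τ hτδ hτ
      have hτ0 : 0 < τ := hτ
      have h1 := norm_aeval_line_le A
        (complexify z + (τ : ℂ) • Complex.I • complexify (u + r • w))
        ((τ : ℂ) • complexify w) hε (fun s hs => by
          have h2 : complexify z + (τ : ℂ) • Complex.I • complexify (u + r • w) +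
              s • (τ : ℂ) • complexify w =
              complexify z + (τ * Complex.I) • complexify (u - ε • w) +
                (τ * (((r + ε : ℝ) : ℂ) * Complex.I + s)) • complexify w := by
            ext j; simp; ring
          rw [h2]
          refine hloc z (by simpa [dist_eq_norm] using hz) _ _ ?_ ?_ ?_ ?_
          · simpa using hτ0.le
          · simp only [norm_mul, Complex.norm_I, Complex.norm_real, Real.norm_eq_abs,
              abs_of_pos hτ0]
            nlinarith
          · have h3 := (abs_le.1 (Complex.abs_im_le_norm s)).1
            rw [Complex.im_ofReal_mul]
            refine mul_pos hτ0 ?_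
            simp only [Complex.add_im, Complex.im_ofReal_mul, Complex.I_im]
            linarith
          · have h3 := norm_add_le (((r + ε : ℝ) : ℂ) * Complex.I) s
            rw [norm_mul, Complex.norm_I, Complex.norm_real, Real.norm_eq_abs,
              abs_of_nonneg (by positivity)] at h3
            rw [norm_mul, Complex.norm_real, Real.norm_eq_abs, abs_of_pos hτ0]
            nlinarith) 1
      rwa [one_smul, add_assoc, ← smul_add] at h1)
  rw [hPom.aeval_smul_vec, aeval_complexify, h0, Complex.ofReal_zero, mul_zero, norm_zero,
    zero_mul, norm_le_zero_iff] at hle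
  have h4 : Complex.I • complexify (u + r • w) + complexify w =
      Complex.I • (complexify u + ((r : ℂ) - Complex.I) • complexify w) := by
    ext j
    simp
    linear_combination (w j : ℂ) * Complex.I_mul_I
  rw [h4, hPom.aeval_smul_vec] at hle
  exact mul_ne_zero (pow_ne_zero _ Complex.I_ne_zero)
    (hPw.aeval_ne_zero hPom u (by simp)) hle
end

section
/- Let Q(X,Y,Z) := 1 − (X + X⁻¹ + Y + Y⁻¹)·Z/2 + Z², regarded as a holomorphic function on (ℂ ∖ {0}) × (ℂ ∖ {0}) × ℂ. Then the set of points (X,Y,Z) with X ≠ 0 and Y ≠ 0 at which Q and its three complex partial derivatives ∂Q/∂X, ∂Q/∂Y, ∂Q/∂Z all vanish is exactly { (1,1,1), (−1,−1,−1) }. -/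
theorem hasDerivAt_add_inv {x : ℂ} (hx : x ≠ 0) :
    HasDerivAt (fun t : ℂ => t + t⁻¹) (1 - (x ^ 2)⁻¹) x := by
  simpa [sub_eq_add_neg] using (hasDerivAt_id' x).fun_add (hasDerivAt_inv hx)

theorem deriv_aztec_first {x : ℂ} (hx : x ≠ 0) (b c z : ℂ) :
    deriv (fun X : ℂ => 1 - (X + X⁻¹ + b + c) * z / 2 + z ^ 2) x =
      -((1 - (x ^ 2)⁻¹) * z / 2) :=
  ((((((hasDerivAt_add_inv hx).add_const b).add_const c).mul_const z).div_const 2).const_sub 1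
    |>.add_const (z ^ 2)).deriv

theorem deriv_aztec_second {y : ℂ} (hy : y ≠ 0) (a b z : ℂ) :
    deriv (fun Y : ℂ => 1 - (a + b + Y + Y⁻¹) * z / 2 + z ^ 2) y =
      -((1 - (y ^ 2)⁻¹) * z / 2) := by
  rw [← deriv_aztec_first hy a b z]
  congr 1
  funext Y
  ring

theorem deriv_aztec_third (s z : ℂ) :
    deriv (fun Z : ℂ => 1 - s * Z / 2 + Z ^ 2) z = -(s / 2) + 2 * z := by
  have h := ((((hasDerivAt_id' z).const_mul s).div_const 2).const_sub 1).fun_add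
    (hasDerivAt_pow 2 z)
  simpa using h.deriv

theorem eq_one_or_eq_neg_one_of_one_sub_inv_sq {x z : ℂ} (hz : z ≠ 0)
    (h : -((1 - (x ^ 2)⁻¹) * z / 2) = 0) : x = 1 ∨ x = -1 := by
  have h' : (x ^ 2)⁻¹ = 1 := by
    have : (1 - (x ^ 2)⁻¹) * z = 0 := by linear_combination -2 * h
    exact (sub_eq_zero.mp ((mul_eq_zero.mp this).resolve_right hz)).symm
  exact eq_or_eq_neg_of_sq_eq_sq x 1 (by simpa using inv_eq_one.mp h')

/-- the singular locus of the Aztec-diamond denominator factor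
`Q(X,Y,Z) = 1 − (X + X⁻¹ + Y + Y⁻¹)Z/2 + Z²` (on `X ≠ 0`, `Y ≠ 0`) is exactly
`{(1,1,1), (−1,−1,−1)}`. -/
theorem aztec_singular_locus :
    {p : ℂ × ℂ × ℂ | p.1 ≠ 0 ∧ p.2.1 ≠ 0 ∧
      1 - (p.1 + p.1⁻¹ + p.2.1 + p.2.1⁻¹) * p.2.2 / 2 + p.2.2 ^ 2 = 0 ∧
      deriv (fun X : ℂ => 1 - (X + X⁻¹ + p.2.1 + p.2.1⁻¹) * p.2.2 / 2 + p.2.2 ^ 2) p.1 = 0 ∧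
      deriv (fun Y : ℂ => 1 - (p.1 + p.1⁻¹ + Y + Y⁻¹) * p.2.2 / 2 + p.2.2 ^ 2) p.2.1 = 0 ∧
      deriv (fun Z : ℂ => 1 - (p.1 + p.1⁻¹ + p.2.1 + p.2.1⁻¹) * Z / 2 + Z ^ 2) p.2.2 = 0} =
    {((1 : ℂ), (1 : ℂ), (1 : ℂ)), ((-1 : ℂ), (-1 : ℂ), (-1 : ℂ))} := by
  ext ⟨x, y, z⟩
  simp only [Set.mem_ofPred_eq, Set.mem_insert_iff, Set.mem_singleton_iff, Prod.mk.injEq]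
  constructor
  · rintro ⟨hx, hy, hQ, hX, hY, hZ⟩
    rw [deriv_aztec_first hx] at hX
    rw [deriv_aztec_second hy] at hY
    rw [deriv_aztec_third] at hZ
    have hz : z ≠ 0 := by
      rintro rfl
      norm_num at hQ
    have hz2 : z ^ 2 = 1 := by linear_combination z * hZ - hQ
    rcases eq_one_or_eq_neg_one_of_one_sub_inv_sq hz hX with rfl | rfl <;>
      rcases eq_one_or_eq_neg_one_of_one_sub_inv_sq hz hY with rfl | rfl
    · left
      norm_num at hZ
      exact ⟨rfl, rfl, by linear_combination hZ / 2⟩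
    · norm_num at hZ
      exact absurd hZ hz
    · norm_num at hZ
      exact absurd hZ hz
    · right
      norm_num at hZ
      exact ⟨rfl, rfl, by linear_combination hZ / 2⟩
  · rintro (⟨rfl, rfl, rfl⟩ | ⟨rfl, rfl, rfl⟩) <;>
      rw [deriv_aztec_first (by norm_num), deriv_aztec_second (by norm_num), deriv_aztec_third] <;>
      norm_num
end

section
/- Let Q(X,Y,Z) := 3 + 3·X·Y·Z − (X + Y + Z + X·Y + X·Z + Y·Z), a polynomial on ℂ³. Then Q(X,Y,Z) = 0, ∂Q/∂X(X,Y,Z) = 0, ∂Q/∂Y(X,Y,Z) = 0 and ∂Q/∂Z(X,Y,Z) = 0 hold simultaneously if and only if (X,Y,Z) = (1,1,1). -/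
theorem deriv_add_mul_self (a b x : ℂ) : deriv (fun w : ℂ => a + b * w) x = b := by
  simp

theorem eq_one_of_add_eq_two_of_mul_eq_one {y z : ℂ} (hs : y + z = 2) (hp : y * z = 1) :
    y = 1 := by
  have h : (y - 1) ^ 2 = 0 := by linear_combination y * hs - hp
  exact sub_eq_zero.mp (pow_eq_zero_iff two_ne_zero |>.mp h)

/-- the cube-grove polynomial `Q = 3 + 3XYZ − (X+Y+Z+XY+XZ+YZ)`
vanishes together with its three partial derivatives exactly at `(1,1,1)`. -/
theorem cube_grove_singular_locus (X Y Z : ℂ) :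
    (3 + 3 * X * Y * Z - (X + Y + Z + X * Y + X * Z + Y * Z) = 0 ∧
      deriv (fun W : ℂ => 3 + 3 * W * Y * Z - (W + Y + Z + W * Y + W * Z + Y * Z)) X = 0 ∧
      deriv (fun W : ℂ => 3 + 3 * X * W * Z - (X + W + Z + X * W + X * Z + W * Z)) Y = 0 ∧
      deriv (fun W : ℂ => 3 + 3 * X * Y * W - (X + Y + W + X * Y + X * W + Y * W)) Z = 0) ↔
    (X = 1 ∧ Y = 1 ∧ Z = 1) := by
  have hX : (fun W : ℂ => 3 + 3 * W * Y * Z - (W + Y + Z + W * Y + W * Z + Y * Z)) =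
      fun W => (3 - (Y + Z + Y * Z)) + (3 * Y * Z - (1 + Y + Z)) * W := by
    funext W; ring
  have hY : (fun W : ℂ => 3 + 3 * X * W * Z - (X + W + Z + X * W + X * Z + W * Z)) =
      fun W => (3 - (X + Z + X * Z)) + (3 * X * Z - (1 + X + Z)) * W := by
    funext W; ring
  have hZ : (fun W : ℂ => 3 + 3 * X * Y * W - (X + Y + W + X * Y + X * W + Y * W)) =
      fun W => (3 - (X + Y + X * Y)) + (3 * X * Y - (1 + X + Y)) * W := by
    funext W; ring
  rw [hX, hY, hZ, deriv_add_mul_self, deriv_add_mul_self, deriv_add_mul_self]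
  constructor
  · rintro ⟨hQ, h₁, h₂, -⟩
    have hYZ : Y * Z = 1 := by linear_combination (-hQ + (X + 1) * h₁) / 4
    have hXZ : X * Z = 1 := by linear_combination (-hQ + (Y + 1) * h₂) / 4
    have hYZs : Y + Z = 2 := by linear_combination 3 * hYZ - h₁
    have hXZs : X + Z = 2 := by linear_combination 3 * hXZ - h₂
    exact ⟨eq_one_of_add_eq_two_of_mul_eq_one hXZs hXZ,
      eq_one_of_add_eq_two_of_mul_eq_one hYZs hYZ,
      eq_one_of_add_eq_two_of_mul_eq_one (add_comm Y Z ▸ hYZs) (mul_comm Y Z ▸ hYZ)⟩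
  · rintro ⟨rfl, rfl, rfl⟩
    norm_num
end
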